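/- arXiv:2210.11008 — 2 statements merged into one kernel-verified Lean document; each statement's English description precedes it below -/
import Mathlib

section
/- Let Ω be a locally compact Hausdorff space with countable base, 0 < q < 1, σ a locally finite Radon measure on Ω, and G a symmetric kernel on Ω satisfying the weak maximum principle with constant 𝔟. Let u be a nontrivial super-solution, i.e., u > 0 σ-a.e. and G(u^q dσ) ≤ u < +∞ σ-a.e. Then u(x) ≥ c Kσ(x), with c = (1−q)^{1/(1−q)} 𝔟^{−q/(1−q)}, at every x ∈ Ω such that u(x) ≥ G(u^q dσ)(x); in particular, this estimate holds σ-a.e. -/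
open MeasureTheory ENNReal Set

noncomputable section

namespace NPE

variable {Ω : Type*} [TopologicalSpace Ω] [MeasurableSpace Ω]

/-- The potential `Gμ(x) = ∫_Ω G(x,y) dμ(y)`. -/
def pot (G : Ω → Ω → ℝ≥0∞) (μ : Measure Ω) (x : Ω) : ℝ≥0∞ :=
  ∫⁻ y, G x y ∂μ

/-- The potential `G(f dσ)(x) = ∫_Ω G(x,y) f(y) dσ(y)`. -/
def potF (G : Ω → Ω → ℝ≥0∞) (σ : Measure Ω) (f : Ω → ℝ≥0∞) (x : Ω) : ℝ≥0∞ :=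
  ∫⁻ y, G x y * f y ∂σ

/-- A kernel on `Ω` is a lower semicontinuous function `Ω × Ω → [0,∞]`. -/
def IsKernel (G : Ω → Ω → ℝ≥0∞) : Prop :=
  LowerSemicontinuous (fun p : Ω × Ω => G p.1 p.2)

/-- A quasi-metric kernel with quasi-metric constant `κ ≥ 1/2`: positive, symmetric and
`d := 1/G` satisfies the quasi-triangle inequality. -/
def IsQuasiMetricKernel (G : Ω → Ω → ℝ≥0∞) (κ : ℝ) : Prop :=
  IsKernel G ∧ (1 / 2 : ℝ) ≤ κ ∧ (∀ x y, 0 < G x y) ∧ (∀ x y, G x y = G y x) ∧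
    ∀ x y z, (G x y)⁻¹ ≤ ENNReal.ofReal κ * ((G x z)⁻¹ + (G z y)⁻¹)

/-- The closed support of a measure. -/
def msupp (μ : Measure Ω) : Set Ω :=
  {x | ∀ U : Set Ω, IsOpen U → x ∈ U → 0 < μ U}

/-- The weak maximum principle with constant `b ≥ 1`. -/
def WMP (G : Ω → Ω → ℝ≥0∞) (b : ℝ) : Prop :=
  1 ≤ b ∧ ∀ μ : Measure Ω, IsLocallyFiniteMeasure μ →
    (∀ x ∈ msupp μ, pot G μ x ≤ 1) → ∀ x, pot G μ x ≤ ENNReal.ofReal b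

/-- Quasi-symmetry with constant `a ≥ 1`. -/
def QS (G : Ω → Ω → ℝ≥0∞) (a : ℝ) : Prop :=
  1 ≤ a ∧ ∀ x y, (ENNReal.ofReal a)⁻¹ * G y x ≤ G x y ∧ G x y ≤ ENNReal.ofReal a * G y x

/-- The `L^q` quasi-norm of a nonnegative function with respect to `σ`. -/
def lqNorm (q : ℝ) (σ : Measure Ω) (f : Ω → ℝ≥0∞) : ℝ≥0∞ :=
  (∫⁻ x, f x ^ q ∂σ) ^ (1 / q)

/-- The least constant `ϰ` in the `(1,q)` weighted norm inequality
`‖Gν‖_{L^q(σ)} ≤ C ‖ν‖` over all finite Radon measures `ν`. -/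
def kappa (G : Ω → Ω → ℝ≥0∞) (q : ℝ) (σ : Measure Ω) : ℝ≥0∞ :=
  sInf {C : ℝ≥0∞ | ∀ ν : Measure Ω, IsFiniteMeasure ν →
    lqNorm q σ (pot G ν) ≤ C * ν Set.univ}

/-- The ball `B(x,r) = {y : G(x,y) > 1/r}`, i.e. `{y : d(x,y) < r}` with `d = 1/G`. -/
def ball (G : Ω → Ω → ℝ≥0∞) (x : Ω) (r : ℝ) : Set Ω :=
  {y | (G x y)⁻¹ < ENNReal.ofReal r}

/-- The intrinsic nonlinear potential
`Kσ(x) = ∫_0^∞ ϰ(B(x,r))^{q/(1-q)} r⁻² dr`. -/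
def kpot (G : Ω → Ω → ℝ≥0∞) (q : ℝ) (σ : Measure Ω) (x : Ω) : ℝ≥0∞ :=
  ∫⁻ r in Set.Ioi (0 : ℝ),
    kappa G q (σ.restrict (ball G x r)) ^ (q / (1 - q)) / ENNReal.ofReal (r ^ 2)

/-- A nontrivial super-solution of `u = G(u^q dσ) + d`:
`u > 0` σ-a.e. and `G(u^q dσ) + d ≤ u < ∞` σ-a.e. -/
def IsSupSol (G : Ω → Ω → ℝ≥0∞) (σ : Measure Ω) (q : ℝ) (d : Ω → ℝ≥0∞)
    (u : Ω → ℝ≥0∞) : Prop :=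
  Measurable u ∧ (∀ᵐ x ∂σ, 0 < u x) ∧
    ∀ᵐ x ∂σ, potF G σ (fun y => u y ^ q) x + d x ≤ u x ∧ u x < ∞

/-- A sub-solution: `u ≤ G(u^q dσ) + d < ∞` σ-a.e. -/
def IsSubSol (G : Ω → Ω → ℝ≥0∞) (σ : Measure Ω) (q : ℝ) (d : Ω → ℝ≥0∞)
    (u : Ω → ℝ≥0∞) : Prop :=
  Measurable u ∧
    ∀ᵐ x ∂σ, u x ≤ potF G σ (fun y => u y ^ q) x + d x ∧
      potF G σ (fun y => u y ^ q) x + d x < ∞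

/-- A nontrivial solution: `u > 0` σ-a.e. and `u = G(u^q dσ) + d`, `u < ∞`, σ-a.e. -/
def IsSol (G : Ω → Ω → ℝ≥0∞) (σ : Measure Ω) (q : ℝ) (d : Ω → ℝ≥0∞)
    (u : Ω → ℝ≥0∞) : Prop :=
  Measurable u ∧ (∀ᵐ x ∂σ, 0 < u x) ∧
    ∀ᵐ x ∂σ, u x = potF G σ (fun y => u y ^ q) x + d x ∧ u x < ∞

/-- The growth conditions `∫_a^∞ σ(B(x₀,r)) r⁻² dr < ∞`,
`∫_a^∞ ϰ(B(x₀,r))^{q/(1-q)} r⁻² dr < ∞` and `∫_a^∞ μ(B(x₀,r)) r⁻² dr < ∞`. -/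
def growthConds (G : Ω → Ω → ℝ≥0∞) (q : ℝ) (σ μ : Measure Ω) (x₀ : Ω) (a : ℝ) : Prop :=
  (∫⁻ r in Set.Ioi a, σ (ball G x₀ r) / ENNReal.ofReal (r ^ 2)) < ∞ ∧
  (∫⁻ r in Set.Ioi a,
      kappa G q (σ.restrict (ball G x₀ r)) ^ (q / (1 - q)) / ENNReal.ofReal (r ^ 2)) < ∞ ∧
  (∫⁻ r in Set.Ioi a, μ (ball G x₀ r) / ENNReal.ofReal (r ^ 2)) < ∞

/-- The modified kernel `G̃(x,y) = G(x,y)/(m(x)m(y))`. -/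
def modKer (G : Ω → Ω → ℝ≥0∞) (m : Ω → ℝ) : Ω → Ω → ℝ≥0∞ :=
  fun x y => G x y / (ENNReal.ofReal (m x) * ENNReal.ofReal (m y))

/-- The modified measure `dσ̃ = m^{1+q} dσ`. -/
def modMeas (σ : Measure Ω) (m : Ω → ℝ) (q : ℝ) : Measure Ω :=
  σ.withDensity fun x => ENNReal.ofReal (m x) ^ ((1 : ℝ) + q)

set_option linter.unusedSectionVars false

def bil (G : Ω → Ω → ℝ≥0∞) (μ ν : Measure Ω) : ℝ≥0∞ := ∫⁻ x, pot G μ x ∂ν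

lemma meas_G [SecondCountableTopology Ω] [BorelSpace Ω] {G : Ω → Ω → ℝ≥0∞} (hG : IsKernel G) :
    Measurable (fun p : Ω × Ω => G p.1 p.2) := LowerSemicontinuous.measurable hG

lemma meas_Gx [SecondCountableTopology Ω] [BorelSpace Ω] {G : Ω → Ω → ℝ≥0∞} (hG : IsKernel G)
    (x : Ω) : Measurable (G x) := (meas_G hG).comp measurable_prodMk_left

lemma meas_pot [SecondCountableTopology Ω] [BorelSpace Ω] {G : Ω → Ω → ℝ≥0∞} (hG : IsKernel G)
    (μ : Measure Ω) [SFinite μ] : Measurable (pot G μ) :=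
  Measurable.lintegral_prod_right' (meas_G hG)

lemma bil_symm [SecondCountableTopology Ω] [BorelSpace Ω] {G : Ω → Ω → ℝ≥0∞} (hG : IsKernel G)
    (hs : ∀ x y, G x y = G y x) (μ ν : Measure Ω) [SFinite μ] [SFinite ν] :
    bil G μ ν = bil G ν μ := by
  unfold bil pot
  rw [lintegral_lintegral_swap (meas_G hG).aemeasurable]
  simp_rw [hs]

lemma bil_add_right (G : Ω → Ω → ℝ≥0∞) (μ ν ρ : Measure Ω) :
    bil G μ (ν + ρ) = bil G μ ν + bil G μ ρ := lintegral_add_measure _ _ _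

lemma bil_smul_right (G : Ω → Ω → ℝ≥0∞) (μ ν : Measure Ω) (s : ℝ≥0∞) :
    bil G μ (s • ν) = s * bil G μ ν := by
  unfold bil; rw [lintegral_smul_measure]; rfl

lemma pot_add (G : Ω → Ω → ℝ≥0∞) (ν ρ : Measure Ω) (x : Ω) :
    pot G (ν + ρ) x = pot G ν x + pot G ρ x := lintegral_add_measure _ _ _

lemma pot_smul (G : Ω → Ω → ℝ≥0∞) (ν : Measure Ω) (s : ℝ≥0∞) (x : Ω) :
    pot G (s • ν) x = s * pot G ν x := by
  unfold pot; rw [lintegral_smul_measure]; rfl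

lemma bil_quad [SecondCountableTopology Ω] [BorelSpace Ω] {G : Ω → Ω → ℝ≥0∞} (hG : IsKernel G)
    (hs : ∀ x y, G x y = G y x) (μ ν : Measure Ω) [IsFiniteMeasure μ] [IsFiniteMeasure ν]
    (s : ℝ) (hs0 : 0 ≤ s) :
    bil G (μ + ENNReal.ofReal s • ν) (μ + ENNReal.ofReal s • ν) =
      bil G μ μ + 2 * ENNReal.ofReal s * bil G μ ν + ENNReal.ofReal (s^2) * bil G ν ν := by
  have : IsFiniteMeasure (ENNReal.ofReal s • ν) := ν.smul_finite ENNReal.ofReal_ne_top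
  rw [bil_add_right, bil_smul_right, bil_symm hG hs _ μ, bil_symm hG hs _ ν,
    bil_add_right, bil_smul_right, bil_add_right, bil_smul_right, bil_symm hG hs ν μ,
    ENNReal.ofReal_pow hs0]
  ring

lemma near_min {G : Ω → Ω → ℝ≥0∞} (E : Set Ω) (C : ℝ) (hC : 0 ≤ C)
    (coer : ∀ μ : Measure Ω, IsFiniteMeasure μ → μ Eᶜ = 0 → bil G μ μ ≠ ∞ →
      (μ univ).toReal ^ 2 ≤ C * (bil G μ μ).toReal) (δ : ℝ) (hδ : 0 < δ) (hδ1 : δ ≤ 1) :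
    ∃ μ : Measure Ω, IsFiniteMeasure μ ∧ μ Eᶜ = 0 ∧ bil G μ μ ≠ ∞ ∧
      (bil G μ μ).toReal ≤ 4 * C + 4 ∧
      ∀ μ' : Measure Ω, IsFiniteMeasure μ' → μ' Eᶜ = 0 → bil G μ' μ' ≠ ∞ →
        (bil G μ μ).toReal / 2 - (μ univ).toReal ≤
          (bil G μ' μ').toReal / 2 - (μ' univ).toReal + δ := by
  let S : Set ℝ := {j | ∃ μ : Measure Ω, IsFiniteMeasure μ ∧ μ Eᶜ = 0 ∧ bil G μ μ ≠ ∞ ∧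
    j = (bil G μ μ).toReal / 2 - (μ univ).toReal}
  have h0 : (0 : ℝ) ∈ S := ⟨0, inferInstance, by simp, by simp [bil], by simp [bil]⟩
  have hb : BddBelow S := by
    refine ⟨-(C / 2), ?_⟩
    rintro j ⟨μ, h1, h2, h3, rfl⟩
    have := coer μ h1 h2 h3
    rcases hC.eq_or_lt with rfl | hC
    · have h4 : (μ univ).toReal = 0 := by nlinarith
      have : 0 ≤ (bil G μ μ).toReal := toReal_nonneg
      rw [h4]; linarith
    · set I := (bil G μ μ).toReal
      set L := (μ univ).toReal
      have : C * (I / 2 - L + C / 2) ≥ 0 := by nlinarith [sq_nonneg (L - C)]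
      have := nonneg_of_mul_nonneg_right this hC
      linarith
  obtain ⟨j, ⟨μ, h1, h2, h3, rfl⟩, hj⟩ := Real.lt_sInf_add_pos ⟨0, h0⟩ hδ
  refine ⟨μ, h1, h2, h3, ?_, ?_⟩
  · have := coer μ h1 h2 h3
    have := csInf_le hb h0
    set I := (bil G μ μ).toReal
    set L := (μ univ).toReal
    by_contra hh
    push Not at hh
    have h5 : I < 2 * L + 2 := by linarith
    nlinarith
  · intro μ' h1' h2' h3'
    have := csInf_le hb ⟨μ', h1', h2', h3', rfl⟩
    linarith

lemma core [LocallyCompactSpace Ω] [T2Space Ω] [SecondCountableTopology Ω] [BorelSpace Ω]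
    {G : Ω → Ω → ℝ≥0∞} (hG : IsKernel G)
    (hs : ∀ x y, G x y = G y x) {b : ℝ} (hW : WMP G b) {E : Set Ω}
    (C : ℝ) (hC : 0 ≤ C)
    (coer : ∀ μ : Measure Ω, IsFiniteMeasure μ → μ Eᶜ = 0 → bil G μ μ ≠ ∞ →
      (μ univ).toReal ^ 2 ≤ C * (bil G μ μ).toReal)
    (ω : Measure Ω) [IsFiniteMeasure ω] (hω : ω Eᶜ = 0) (M : ℝ) (hM0 : 0 ≤ M)
    (hM : ∀ x ∈ E, pot G ω x ≤ ENNReal.ofReal M) (ε : ℝ) (hε : 0 < ε) :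
    ∃ μ : Measure Ω, IsFiniteMeasure μ ∧ μ Eᶜ = 0 ∧
      (∀ x, pot G μ x ≤ ENNReal.ofReal (1 + ε) * ENNReal.ofReal b) ∧
      ω univ ≤ bil G ω μ + ENNReal.ofReal ε := by
  have bilM : ∀ μ : Measure Ω, IsFiniteMeasure μ → μ Eᶜ = 0 →
      bil G ω μ ≤ ENNReal.ofReal M * μ univ := by
    intro μ _ hμ
    unfold bil
    calc ∫⁻ x, pot G ω x ∂μ ≤ ∫⁻ x, ENNReal.ofReal M ∂μ := by
          apply lintegral_mono_ae
          have : ∀ᵐ x ∂μ, x ∈ E := hμ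
          filter_upwards [this] with x hx using hM x hx
      _ = _ := by simp
  have hIω : bil G ω ω ≠ ∞ :=
    ne_top_of_le_ne_top (mul_ne_top ofReal_ne_top (measure_ne_top ω _)) (bilM ω ‹_› hω)
  set I := (bil G ω ω).toReal with hI
  have hI0 : 0 ≤ I := toReal_nonneg
  set D := 4 * C + 4
  set P := (1 + I / 2) + M * ((1 + D / 2) / ε + 1) with hP
  have hD : 0 < D := by positivity
  have hP0 : 0 < P := by positivity
  obtain ⟨s, hs0, hs1, hsP⟩ : ∃ s : ℝ, 0 < s ∧ s ≤ 1 ∧ s * P ≤ ε := by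
    refine ⟨min 1 (ε / P), by positivity, min_le_left _ _, ?_⟩
    calc _ ≤ (ε / P) * P := by gcongr; exact min_le_right _ _
      _ = ε := by field_simp
  obtain ⟨μ, hμ, hμE, hμI, hμD, hmin⟩ := near_min (G := G) E C hC coer (s ^ 2) (by positivity)
    (by nlinarith)
  have hcross : bil G ω μ ≠ ∞ :=
    ne_top_of_le_ne_top (mul_ne_top ofReal_ne_top (measure_ne_top μ _)) (bilM μ hμ hμE)
  -- up variation
  have hup : (ω univ).toReal ≤ (bil G ω μ).toReal + s * (1 + I / 2) := by
    have hfin : IsFiniteMeasure (ENNReal.ofReal s • ω) := ω.smul_finite ENNReal.ofReal_ne_top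
    have hq := bil_quad hG hs μ ω s hs0.le
    rw [bil_symm hG hs μ ω] at hq
    have h1 := hmin (μ + ENNReal.ofReal s • ω) inferInstance (by simp [hμE, hω])
      (by rw [hq]; finiteness)
    rw [hq, toReal_add (by finiteness) (by finiteness), toReal_add (by finiteness) (by finiteness)]
      at h1
    simp only [toReal_mul, toReal_ofReal hs0.le, toReal_ofReal (sq_nonneg s), Measure.add_apply,
      Measure.smul_apply, smul_eq_mul, toReal_ofNat] at h1
    rw [toReal_add (by finiteness) (by finiteness), toReal_mul, toReal_ofReal hs0.le] at h1
    refine le_of_mul_le_mul_left ?_ hs0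
    nlinarith
  -- down variation
  let good : Set Ω := {x | pot G μ x ≤ ENNReal.ofReal (1 + ε)}
  have hgood : MeasurableSet good := measurableSet_le (meas_pot hG μ) measurable_const
  have hdown : (μ goodᶜ).toReal ≤ s * ((1 + D / 2) / ε) := by
    set g := μ.restrict good with hg
    set c := μ.restrict goodᶜ with hc
    have hsum : μ = g + c := (Measure.restrict_add_restrict_compl hgood).symm
    have hq1 := bil_quad hG hs g c 1 zero_le_one
    have hq2 := bil_quad hG hs g c (1 - s) (by linarith)
    simp only [ofReal_one, one_smul, mul_one, one_pow, one_mul] at hq1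
    rw [← hsum] at hq1
    have hgg : bil G g g ≠ ∞ := fun h => hμI (by rw [hq1, h]; simp)
    have hcc : bil G c c ≠ ∞ := fun h => hμI (by rw [hq1, h]; simp)
    have hgc : bil G g c ≠ ∞ := fun h => hμI (by rw [hq1, h]; simp)
    have hfin : IsFiniteMeasure (ENNReal.ofReal (1 - s) • c) :=
      c.smul_finite ENNReal.ofReal_ne_top
    have hgE : g Eᶜ = 0 := le_antisymm ((Measure.restrict_apply_le _ _).trans hμE.le) bot_le
    have hcE : c Eᶜ = 0 := le_antisymm ((Measure.restrict_apply_le _ _).trans hμE.le) bot_le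
    have h1 := hmin (g + ENNReal.ofReal (1 - s) • c) inferInstance (by simp [hgE, hcE])
      (by rw [hq2]; finiteness)
    have hcu : c univ = μ goodᶜ := by simp [hc]
    have hlow : ENNReal.ofReal (1 + ε) * c univ ≤ bil G g c + bil G c c := by
      have : bil G g c + bil G c c = bil G μ c := by
        rw [bil_symm hG hs g c, ← bil_add_right, ← hsum, bil_symm hG hs]
      rw [this, hcu]
      calc _ = ∫⁻ x in goodᶜ, ENNReal.ofReal (1 + ε) ∂μ := by simp
        _ ≤ _ := by
          apply setLIntegral_mono (meas_pot hG μ)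
          intro x hx
          have hx' : ¬ (pot G μ x ≤ ENNReal.ofReal (1 + ε)) := hx
          exact (not_le.1 hx').le
    have hlow' := toReal_mono (by finiteness) hlow
    have hμu : (μ univ).toReal = (g univ).toReal + (c univ).toReal := by
      conv_lhs => rw [hsum]
      rw [Measure.add_apply, toReal_add (by finiteness) (by finiteness)]
    have hμI' : (bil G μ μ).toReal =
      (bil G g g).toReal + 2 * (bil G g c).toReal + (bil G c c).toReal := by
      rw [hq1, toReal_add (by finiteness) (by finiteness),
        toReal_add (by finiteness) (by finiteness)]
      simp
    rw [hq2, toReal_add (by finiteness) (by finiteness),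
      toReal_add (by finiteness) (by finiteness)] at h1
    have hs' : 0 ≤ 1 - s := by linarith
    simp only [toReal_mul, toReal_ofReal hs', toReal_ofReal (sq_nonneg (1 - s)),
      Measure.add_apply, Measure.smul_apply, smul_eq_mul, toReal_ofNat] at h1
    rw [toReal_add (by finiteness) (by finiteness), toReal_mul, toReal_ofReal hs', hμu] at h1
    rw [toReal_mul, toReal_ofReal (by positivity),
      toReal_add (by finiteness) (by finiteness)] at hlow'
    rw [← hcu]
    have k1 : 0 ≤ (bil G g g).toReal := toReal_nonneg
    have k2 : 0 ≤ (bil G g c).toReal := toReal_nonneg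
    have k3 : 0 ≤ (bil G c c).toReal := toReal_nonneg
    rw [hμI'] at h1 hμD
    generalize (bil G g g).toReal = a1 at *
    generalize (bil G g c).toReal = a2 at *
    generalize (bil G c c).toReal = a3 at *
    generalize (c univ).toReal = m at *
    have : s * (m * ε) ≤ s * (s * (1 + D / 2)) := by nlinarith
    have := le_of_mul_le_mul_left this hs0
    rw [← mul_div_assoc, le_div_iff₀ hε]
    exact this
  obtain ⟨A, hAsub, hA, hAlt⟩ := hgood.exists_isClosed_sdiff_lt (μ := μ) (measure_ne_top _ _)
    (ε := ENNReal.ofReal s) (by simpa using hs0)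
  have hAm := hA.measurableSet
  have hAc : μ Aᶜ ≤ ENNReal.ofReal (s * ((1 + D / 2) / ε + 1)) := by
    calc μ Aᶜ ≤ μ (goodᶜ ∪ (good \ A)) := by
          apply measure_mono
          intro x hx
          by_cases h : x ∈ good
          · exact Or.inr ⟨h, hx⟩
          · exact Or.inl h
      _ ≤ μ goodᶜ + μ (good \ A) := measure_union_le _ _
      _ ≤ ENNReal.ofReal (s * ((1 + D / 2) / ε)) + ENNReal.ofReal s := by
          gcongr
          exact (le_ofReal_iff_toReal_le (by finiteness) (by positivity)).2 hdown
      _ = _ := by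
          rw [← ofReal_add (by positivity) (by positivity)]; ring_nf
  refine ⟨μ.restrict A, inferInstance,
    le_antisymm ((Measure.restrict_apply_le _ _).trans hμE.le) bot_le, ?_, ?_⟩
  · have hpos : ENNReal.ofReal (1 + ε) ≠ 0 := by simp; linarith
    have hfin : IsFiniteMeasure ((ENNReal.ofReal (1 + ε))⁻¹ • μ.restrict A) :=
      (μ.restrict A).smul_finite (by finiteness)
    have := hW.2 ((ENNReal.ofReal (1 + ε))⁻¹ • μ.restrict A) inferInstance ?_
    · intro x
      have := this x
      rw [pot_smul] at this
      rwa [ENNReal.inv_mul_le_iff hpos ofReal_ne_top] at this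
    · intro x hx
      have hxA : x ∈ A := by
        by_contra hxA
        have := hx Aᶜ hA.isOpen_compl hxA
        rw [Measure.smul_apply, Measure.restrict_apply hAm.compl] at this
        simp at this
      rw [pot_smul, ENNReal.inv_mul_le_iff hpos ofReal_ne_top, mul_one]
      calc pot G (μ.restrict A) x ≤ pot G μ x := lintegral_mono' Measure.restrict_le_self le_rfl
        _ ≤ _ := hAsub hxA
  · have hsplit : bil G ω μ = bil G ω (μ.restrict A) + bil G ω (μ.restrict Aᶜ) := by
      rw [← bil_add_right, Measure.restrict_add_restrict_compl hAm]
    have h2 := bilM (μ.restrict Aᶜ) inferInstance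
      (le_antisymm ((Measure.restrict_apply_le _ _).trans hμE.le) bot_le)
    rw [Measure.restrict_apply_univ] at h2
    calc ω univ = ENNReal.ofReal (ω univ).toReal := (ofReal_toReal (by finiteness)).symm
      _ ≤ ENNReal.ofReal ((bil G ω μ).toReal + s * (1 + I / 2)) := ofReal_le_ofReal hup
      _ = bil G ω μ + ENNReal.ofReal (s * (1 + I / 2)) := by
          rw [ofReal_add toReal_nonneg (by positivity), ofReal_toReal hcross]
      _ ≤ bil G ω (μ.restrict A) + ENNReal.ofReal M * ENNReal.ofReal (s * ((1 + D / 2) / ε + 1)) +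
          ENNReal.ofReal (s * (1 + I / 2)) := by
          rw [hsplit]
          gcongr
          exact h2.trans (by gcongr)
      _ = bil G ω (μ.restrict A) + ENNReal.ofReal (s * P) := by
          rw [add_assoc, ← ofReal_mul hM0, ← ofReal_add (by positivity) (by positivity)]
          congr 2
          rw [hP]; ring
      _ ≤ _ := by gcongr

lemma exists_V [SecondCountableTopology Ω] [BorelSpace Ω]
    {G : Ω → Ω → ℝ≥0∞} (hG : IsKernel G) :
    ∃ V : ℕ → Set Ω, (∀ n, MeasurableSet (V n)) ∧
      (∀ n, ∃ a : ℝ, 0 < a ∧ ∀ x ∈ V n, ∀ y ∈ V n, ENNReal.ofReal a ≤ G x y) ∧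
      ∀ x, G x x ≠ 0 → ∃ n, x ∈ V n := by
  let T : Set (Set Ω) := insert ∅ {U ∈ TopologicalSpace.countableBasis Ω |
    ∃ a : ℝ, 0 < a ∧ ∀ x ∈ U, ∀ y ∈ U, ENNReal.ofReal a ≤ G x y}
  have hT : T.Countable :=
    ((TopologicalSpace.countable_countableBasis Ω).mono (sep_subset _ _)).insert _
  obtain ⟨V, hV⟩ := hT.exists_eq_range ⟨∅, mem_insert _ _⟩
  have hVT : ∀ n, V n ∈ T := fun n => hV ▸ mem_range_self n
  refine ⟨V, fun n => ?_, fun n => ?_, fun x hx => ?_⟩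
  · rcases hVT n with h | h
    · rw [h]; exact MeasurableSet.empty
    · exact (TopologicalSpace.isOpen_of_mem_countableBasis h.1).measurableSet
  · rcases hVT n with h | h
    · exact ⟨1, one_pos, by simp [h]⟩
    · exact h.2
  · obtain ⟨a, ha0, ha⟩ : ∃ a : ℝ, 0 < a ∧ ENNReal.ofReal a < G x x := by
      obtain ⟨r, hr0, hr⟩ := ENNReal.lt_iff_exists_nnreal_btwn.1 (pos_iff_ne_zero.2 hx)
      exact ⟨r, by simpa using hr0, by simpa using hr⟩
    have h1 := hG (x, x) _ ha
    rw [nhds_prod_eq, ((TopologicalSpace.isBasis_countableBasis Ω).nhds_hasBasis).prod_self.eventually_iff] at h1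
    obtain ⟨U, ⟨hU, hxU⟩, hUG⟩ := h1
    have : U ∈ T := Or.inr ⟨hU, a, ha0, fun y hy z hz => (hUG (Set.mk_mem_prod hy hz)).le⟩
    rw [hV] at this
    obtain ⟨n, rfl⟩ := this
    exact ⟨n, hxU⟩

lemma G_zero [T2Space Ω] [SecondCountableTopology Ω] [BorelSpace Ω]
    {G : Ω → Ω → ℝ≥0∞}
    (hs : ∀ x y, G x y = G y x) {b : ℝ} (hW : WMP G b) (x : Ω) (hx : G x x = 0) (y : Ω) :
    G x y = 0 := by
  have h : ∀ n : ℕ, (n : ℝ≥0∞) * G y x ≤ ENNReal.ofReal b := by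
    intro n
    have hfin : IsFiniteMeasure ((n : ℝ≥0∞) • Measure.dirac x) :=
      (Measure.dirac x).smul_finite (by finiteness)
    have := hW.2 ((n : ℝ≥0∞) • Measure.dirac x) inferInstance (fun z hz => ?_) y
    · rw [pot_smul] at this
      simpa [pot] using this
    · have hzx : z = x := by
        by_contra hne
        have := hz {x}ᶜ isOpen_compl_singleton hne
        simp at this
      rw [pot_smul]
      simp [pot, hzx, hx]
  rw [hs]
  by_contra hne
  obtain ⟨n, hn⟩ := ENNReal.exists_nat_mul_gt hne (ofReal_ne_top (r := b))
  exact absurd (h n) (not_le.2 hn)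

lemma weak_type [LocallyCompactSpace Ω] [T2Space Ω] [SecondCountableTopology Ω] [BorelSpace Ω]
    {G : Ω → Ω → ℝ≥0∞} (hG : IsKernel G)
    (hs : ∀ x y, G x y = G y x) {b : ℝ} (hW : WMP G b)
    (ω : Measure Ω) [IsFiniteMeasure ω] (hω : ∀ᵐ x ∂ω, pot G ω x < ∞)
    (ν : Measure Ω) [IsFiniteMeasure ν] (t : ℝ≥0∞) (ht : t ≠ ∞) :
    t * ω {x | t * pot G ω x < pot G ν x} ≤ ENNReal.ofReal b * ν univ := by
  obtain ⟨V, hVm, hVa, hV⟩ := exists_V hG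
  choose a ha0 ha using hVa
  set E : Set Ω := {x | t * pot G ω x < pot G ν x} with hE
  have hEm : MeasurableSet E :=
    measurableSet_lt ((meas_pot hG ω).const_mul t) (meas_pot hG ν)
  let F : ℕ → Set Ω := fun N => E ∩ ((⋃ i ∈ Finset.range N, V i) ∩ {x | pot G ω x ≤ (N : ℝ≥0∞)})
  have hFm : ∀ N, MeasurableSet (F N) := fun N =>
    hEm.inter ((Finset.measurableSet_biUnion _ (fun i _ => hVm i)).inter
      (measurableSet_le (meas_pot hG ω) measurable_const))
  have hFmono : Monotone F := by
    intro m n hmn x hx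
    have hx2 : pot G ω x ≤ (m : ℝ≥0∞) := hx.2.2
    refine ⟨hx.1, ?_, hx2.trans (Nat.cast_le.2 hmn)⟩
    have := hx.2.1
    simp only [mem_iUnion, Finset.mem_range] at this ⊢
    obtain ⟨i, hi, h⟩ := this
    exact ⟨i, hi.trans_le hmn, h⟩
  have hωE : ω E = ω (⋃ N, F N) := by
    apply measure_congr
    filter_upwards [hω] with x hx
    apply propext
    change x ∈ E ↔ x ∈ ⋃ N, F N
    constructor
    · intro hxE
      have hxx : G x x ≠ 0 := by
        intro h0
        have : pot G ν x = 0 := by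
          unfold pot
          simp [G_zero hs hW x h0]
        have h3 : t * pot G ω x < pot G ν x := hxE
        rw [this] at h3
        exact not_lt_bot h3
      obtain ⟨n, hn⟩ := hV x hxx
      obtain ⟨m, hm⟩ := ENNReal.exists_nat_gt hx.ne
      refine mem_iUnion.2 ⟨max (n + 1) m, hxE, ?_, ?_⟩
      · simp only [mem_iUnion, Finset.mem_range]
        exact ⟨n, by omega, hn⟩
      · refine hm.le.trans ?_
        exact_mod_cast le_max_right _ _
    · intro h
      obtain ⟨N, hN⟩ := mem_iUnion.1 h
      exact hN.1
  rw [hωE, hFmono.measure_iUnion, ENNReal.mul_iSup]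
  refine iSup_le fun N => ?_
  have coer : ∀ μ : Measure Ω, IsFiniteMeasure μ → μ (F N)ᶜ = 0 → bil G μ μ ≠ ∞ →
      (μ univ).toReal ^ 2 ≤ (∑ i ∈ Finset.range N, 1 / √(a i)) ^ 2 * (bil G μ μ).toReal := by
    intro μ _ hμ hfin
    set I := (bil G μ μ).toReal
    have h1 : ∀ i, (μ (V i)).toReal ≤ 1 / √(a i) * √I := by
      intro i
      have h2 : ENNReal.ofReal (a i) * μ (V i) * μ (V i) ≤ bil G μ μ := by
        calc _ = ∫⁻ x in V i, ∫⁻ y in V i, ENNReal.ofReal (a i) ∂μ ∂μ := by simp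
          _ ≤ ∫⁻ x in V i, pot G μ x ∂μ := by
            apply setLIntegral_mono (meas_pot hG μ)
            intro x hx
            calc _ ≤ ∫⁻ y in V i, G x y ∂μ := by
                  apply setLIntegral_mono (meas_Gx hG x)
                  intro y hy
                  exact ha i x hx y hy
              _ ≤ _ := setLIntegral_le_lintegral _ _
          _ ≤ _ := setLIntegral_le_lintegral _ _
      have h3 := toReal_mono hfin h2
      rw [toReal_mul, toReal_mul, toReal_ofReal (ha0 i).le] at h3
      have h4 : √(a i) * (μ (V i)).toReal ≤ √I := by
        apply Real.le_sqrt_of_sq_le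
        rw [mul_pow, Real.sq_sqrt (ha0 i).le]
        change _ ≤ (bil G μ μ).toReal
        linarith
      rw [div_mul_eq_mul_div, le_div_iff₀ (Real.sqrt_pos.2 (ha0 i))]
      linarith
    have h2 : μ univ ≤ ∑ i ∈ Finset.range N, μ (V i) := by
      calc μ univ = μ (F N) := by
            rw [← measure_add_measure_compl (hFm N), hμ, add_zero]
        _ ≤ μ (⋃ i ∈ Finset.range N, V i) := measure_mono fun x hx => hx.2.1
        _ ≤ _ := measure_biUnion_finset_le _ _
    have h3 : (μ univ).toReal ≤ (∑ i ∈ Finset.range N, 1 / √(a i)) * √I := by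
      refine (toReal_mono (sum_ne_top.2 fun _ _ => measure_ne_top _ _) h2).trans ?_
      rw [toReal_sum (fun _ _ => by finiteness), Finset.sum_mul]
      exact Finset.sum_le_sum fun i _ => h1 i
    calc _ ≤ ((∑ i ∈ Finset.range N, 1 / √(a i)) * √I) ^ 2 :=
          pow_le_pow_left₀ toReal_nonneg h3 2
      _ = _ := by rw [mul_pow, Real.sq_sqrt toReal_nonneg]
  have key : ∀ ε : ℝ, 0 < ε → t * ω (F N) ≤
      ENNReal.ofReal (1 + ε) * ENNReal.ofReal b * ν univ + t * ENNReal.ofReal ε := by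
    intro ε hε
    have hle : ∀ x, pot G (ω.restrict (F N)) x ≤ pot G ω x := fun x =>
      lintegral_mono' Measure.restrict_le_self le_rfl
    obtain ⟨μ, hμ, hμE, hμb, hμω⟩ := core hG hs hW _ (sq_nonneg _) coer
      (ω.restrict (F N)) (by rw [Measure.restrict_apply (hFm N).compl]; simp) N
      (Nat.cast_nonneg N) (fun x hx => (hle x).trans (by simpa using hx.2.2)) ε hε
    rw [Measure.restrict_apply_univ] at hμω
    calc t * ω (F N) ≤ t * (bil G (ω.restrict (F N)) μ + ENNReal.ofReal ε) := by gcongr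
      _ = t * bil G (ω.restrict (F N)) μ + t * ENNReal.ofReal ε := mul_add _ _ _
      _ ≤ _ := by
        refine add_le_add_left ?_ _
        calc t * bil G (ω.restrict (F N)) μ = ∫⁻ x, t * pot G (ω.restrict (F N)) x ∂μ := by
              unfold bil
              rw [lintegral_const_mul _ (meas_pot hG _)]
          _ ≤ ∫⁻ x, pot G ν x ∂μ := by
              apply lintegral_mono_ae
              have : ∀ᵐ x ∂μ, x ∈ F N := hμE
              filter_upwards [this] with x hx
              have h3 : t * pot G ω x < pot G ν x := hx.1
              exact le_trans (by gcongr; exact hle x) h3.le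
          _ = bil G μ ν := bil_symm hG hs ν μ
          _ ≤ ∫⁻ x, ENNReal.ofReal (1 + ε) * ENNReal.ofReal b ∂ν := lintegral_mono hμb
          _ = _ := by simp
  have lim : Filter.Tendsto (fun ε : ℝ => ENNReal.ofReal (1 + ε) * ENNReal.ofReal b * ν univ +
      t * ENNReal.ofReal ε) (nhdsWithin 0 (Ioi 0))
      (nhds (ENNReal.ofReal (1 + 0) * ENNReal.ofReal b * ν univ + t * ENNReal.ofReal 0)) := by
    apply Filter.Tendsto.mono_left _ nhdsWithin_le_nhds
    have e1 : Filter.Tendsto (fun ε : ℝ => ENNReal.ofReal (1 + ε)) (nhds 0)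
      (nhds (ENNReal.ofReal (1 + 0))) :=
      ENNReal.tendsto_ofReal (Filter.Tendsto.const_add 1 Filter.tendsto_id)
    have e2 : Filter.Tendsto (fun ε : ℝ => ENNReal.ofReal ε) (nhds 0)
      (nhds (ENNReal.ofReal 0)) := ENNReal.tendsto_ofReal Filter.tendsto_id
    refine Filter.Tendsto.add ?_ (ENNReal.Tendsto.const_mul e2 (Or.inr ht))
    exact ENNReal.Tendsto.mul_const (ENNReal.Tendsto.mul_const e1 (Or.inr (by finiteness)))
      (Or.inr (by finiteness))
  have := ge_of_tendsto lim (b := t * ω (F N)) (by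
    filter_upwards [self_mem_nhdsWithin] with ε hε using key ε hε)
  simpa using this

lemma lint_Ioc (q T : ℝ) (hq0 : 0 < q) (hT : 0 < T) :
    ∫⁻ t in Ioc 0 T, ENNReal.ofReal (t ^ (q - 1)) = ENNReal.ofReal (T ^ q / q) := by
  have hi := intervalIntegral.intervalIntegrable_rpow' (a := 0) (b := T) (r := q - 1) (by linarith)
  rw [intervalIntegrable_iff_integrableOn_Ioc_of_le hT.le] at hi
  rw [← ofReal_integral_eq_lintegral_ofReal hi]
  · rw [← intervalIntegral.integral_of_le hT.le, integral_rpow (Or.inl (by linarith))]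
    simp [Real.zero_rpow hq0.ne']
  · filter_upwards [ae_restrict_mem measurableSet_Ioc] with t ht
    exact Real.rpow_nonneg ht.1.le _

lemma lint_Ioi (q T : ℝ) (hq1 : q < 1) (hT : 0 < T) :
    ∫⁻ t in Ioi T, ENNReal.ofReal (t ^ (q - 2)) = ENNReal.ofReal (T ^ (q - 1) / (1 - q)) := by
  have hi := integrableOn_Ioi_rpow_of_lt (a := q - 2) (by linarith) hT
  rw [← ofReal_integral_eq_lintegral_ofReal hi]
  · rw [integral_Ioi_rpow_of_lt (by linarith) hT]
    congr 1
    rw [show q - 2 + 1 = q - 1 by ring, neg_div, ← div_neg]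
    congr 1
    ring
  · filter_upwards [ae_restrict_mem measurableSet_Ioi] with t ht
    exact Real.rpow_nonneg (hT.trans ht).le _

lemma strong (ω : Measure Ω) [IsFiniteMeasure ω] (g : Ω → ℝ≥0∞) (hg : Measurable g) (q B : ℝ)
    (hq0 : 0 < q) (hq1 : q < 1) (hB : 0 ≤ B)
    (hw : ∀ t : ℝ, 0 < t → ENNReal.ofReal t * ω {x | ENNReal.ofReal t < g x} ≤ ENNReal.ofReal B) :
    ∫⁻ x, g x ^ q ∂ω ≤ ENNReal.ofReal ((ω univ).toReal ^ (1 - q) * B ^ q / (1 - q)) := by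
  have hw' : ∀ t : ℝ, 0 < t → ω {x | ENNReal.ofReal t < g x} ≤ ENNReal.ofReal (B / t) := by
    intro t ht
    rw [ofReal_div_of_pos ht, ENNReal.le_div_iff_mul_le (by simp [ht]) (by simp), mul_comm]
    exact hw t ht
  rcases eq_or_ne (ω univ) 0 with hW | hW
  · rw [Measure.measure_univ_eq_zero.1 hW]; simp
  rcases hB.eq_or_lt with rfl | hB
  · have : ∀ᵐ x ∂ω, g x = 0 := by
      have h1 : ∀ n : ℕ, ∀ᵐ x ∂ω, g x ≤ ENNReal.ofReal (1 / (n + 1)) := by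
        intro n
        have := hw' (1 / (n + 1)) (by positivity)
        rw [zero_div, ofReal_zero] at this
        have := le_antisymm this bot_le
        rw [ae_iff]
        simpa using this
      filter_upwards [ae_all_iff.2 h1] with x hx
      have hl : Filter.Tendsto (fun n : ℕ => ENNReal.ofReal (1 / ((n : ℝ) + 1))) Filter.atTop
        (nhds (ENNReal.ofReal 0)) := ENNReal.tendsto_ofReal tendsto_one_div_add_atTop_nhds_zero_nat
      have := ge_of_tendsto' hl hx
      simpa using this
    have : ∫⁻ x, g x ^ q ∂ω = 0 := by
      rw [lintegral_eq_zero_iff (hg.pow_const q)]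
      filter_upwards [this] with x hx
      simp [hx, hq0]
    rw [this]; exact bot_le
  have hgfin : ∀ᵐ x ∂ω, g x < ∞ := by
    have hl : Filter.Tendsto (fun t : ℝ => ENNReal.ofReal (B / t)) Filter.atTop
        (nhds (ENNReal.ofReal 0)) :=
      ENNReal.tendsto_ofReal (Filter.Tendsto.const_div_atTop Filter.tendsto_id B)
    have := ge_of_tendsto hl (b := ω {x | ¬ g x < ∞}) (by
      filter_upwards [Filter.eventually_gt_atTop 0] with t ht
      refine le_trans (measure_mono ?_) (hw' t ht)
      intro x hx
      have : g x = ∞ := by simpa using hx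
      simp [this])
    rw [ae_iff]
    simpa using this
  set W := (ω univ).toReal with hWdef
  have hW0 : 0 < W := toReal_pos hW (measure_ne_top _ _)
  have hWof : ENNReal.ofReal W = ω univ := ofReal_toReal (measure_ne_top _ _)
  set T := B / W with hT
  have hT0 : 0 < T := by positivity
  have e1 : ∫⁻ x, g x ^ q ∂ω = ∫⁻ x, ENNReal.ofReal ((g x).toReal ^ q) ∂ω := by
    apply lintegral_congr_ae
    filter_upwards [hgfin] with x hx
    rw [← ENNReal.ofReal_rpow_of_nonneg toReal_nonneg hq0.le, ofReal_toReal hx.ne]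
  rw [e1, lintegral_rpow_eq_lintegral_meas_lt_mul ω (ae_of_all _ fun x => toReal_nonneg)
    hg.ennreal_toReal.aemeasurable hq0]
  have hsub : ∀ t : ℝ, 0 < t → ω {a | t < (g a).toReal} ≤ ENNReal.ofReal (B / t) := by
    intro t ht
    refine le_trans (measure_mono ?_) (hw' t ht)
    intro x hx
    exact (ofReal_lt_iff_lt_toReal ht.le (fun h => by simp [h] at hx; linarith)).2 hx
  have e2 : ∫⁻ t in Ioi (0:ℝ), ω {a | t < (g a).toReal} * ENNReal.ofReal (t ^ (q - 1)) ≤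
      ENNReal.ofReal (W * (T ^ q / q)) + ENNReal.ofReal (B * (T ^ (q - 1) / (1 - q))) := by
    rw [← Ioc_union_Ioi_eq_Ioi hT0.le]
    refine (lintegral_union_le _ _ _).trans ?_
    gcongr
    · rw [ofReal_mul hW0.le, ← lint_Ioc q T hq0 hT0, ← lintegral_const_mul' _ _ ofReal_ne_top]
      apply lintegral_mono
      intro t
      dsimp only
      gcongr
      rw [hWof]
      exact measure_mono (subset_univ _)
    · rw [ofReal_mul hB.le, ← lint_Ioi q T hq1 hT0, ← lintegral_const_mul' _ _ ofReal_ne_top]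
      apply lintegral_mono_ae
      filter_upwards [ae_restrict_mem measurableSet_Ioi] with t ht
      have ht0 : 0 < t := hT0.trans ht
      calc _ ≤ ENNReal.ofReal (B / t) * ENNReal.ofReal (t ^ (q - 1)) := by
            gcongr; exact hsub t ht0
        _ = _ := by
          rw [← ofReal_mul (by positivity), ← ofReal_mul hB.le]
          congr 1
          rw [show q - 2 = (q - 1) - 1 by ring, Real.rpow_sub_one ht0.ne' (q - 1)]
          ring
  refine (mul_le_mul_right e2 _).trans ?_
  have hq1' : 0 < 1 - q := by linarith
  rw [← ofReal_add (by positivity) (by positivity), ← ofReal_mul hq0.le]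
  apply ofReal_le_ofReal
  apply le_of_eq
  have f1 : W * T ^ q = W ^ (1 - q) * B ^ q := by
    rw [hT, Real.div_rpow hB.le hW0.le, Real.rpow_sub hW0, Real.rpow_one]; ring
  have f2 : B * T ^ (q - 1) = W ^ (1 - q) * B ^ q := by
    rw [hT, Real.div_rpow hB.le hW0.le, show 1 - q = -(q - 1) by ring, Real.rpow_neg hW0.le,
      Real.rpow_sub hB, Real.rpow_one]
    field_simp
  calc _ = W * T ^ q + q * (B * T ^ (q - 1)) / (1 - q) := by field_simp
    _ = _ := by rw [f1, f2]; field_simp; ring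

lemma ball_est [LocallyCompactSpace Ω] [T2Space Ω] [SecondCountableTopology Ω]
    [BorelSpace Ω] (G : Ω → Ω → ℝ≥0∞) (q b : ℝ) (hq0 : 0 < q) (hq1 : q < 1)
    (σ : Measure Ω) [IsLocallyFiniteMeasure σ] (hGk : IsKernel G)
    (hsymm : ∀ x y, G x y = G y x) (hWMP : WMP G b)
    (u : Ω → ℝ≥0∞) (hu : Measurable u) (hupos : ∀ᵐ x ∂σ, 0 < u x)
    (husup : ∀ᵐ x ∂σ, potF G σ (fun y => u y ^ q) x ≤ u x ∧ u x < ∞)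
    (S : Set Ω) (hS : MeasurableSet S) :
    ENNReal.ofReal ((1 - q) ^ ((1 : ℝ) / (1 - q)) * b ^ (-(q / (1 - q)))) *
      kappa G q (σ.restrict S) ^ (q / (1 - q)) ≤ (σ.withDensity (fun y => u y ^ q)) S := by
  have hb1 := hWMP.1
  have hb : 0 < b := by linarith
  have hq1' : 0 < 1 - q := by linarith
  have huq : Measurable (fun y => u y ^ q) := hu.pow_const q
  rcases eq_or_ne ((σ.withDensity (fun y => u y ^ q)) S) ∞ with htop | htop
  · rw [htop]; exact le_top
  set ω := (σ.withDensity (fun y => u y ^ q)).restrict S with hω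
  have hfin : IsFiniteMeasure ω := ⟨by rw [hω, Measure.restrict_apply_univ]; exact htop.lt_top⟩
  have hω2 : ω = (σ.restrict S).withDensity (fun y => u y ^ q) := restrict_withDensity hS _
  have hωu : ω univ = (σ.withDensity (fun y => u y ^ q)) S := by
    rw [hω, Measure.restrict_apply_univ]
  have hpot : ∀ x, pot G ω x ≤ potF G σ (fun y => u y ^ q) x := by
    intro x
    calc pot G ω x ≤ pot G (σ.withDensity (fun y => u y ^ q)) x :=
          lintegral_mono' Measure.restrict_le_self le_rfl
      _ = _ := by
        unfold pot potF
        rw [lintegral_withDensity_eq_lintegral_mul _ huq (meas_Gx hGk x)]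
        simp [mul_comm]
  have hac : ω ≪ σ :=
    Measure.absolutelyContinuous_of_le Measure.restrict_le_self |>.trans
      (withDensity_absolutelyContinuous _ _)
  have hωsup := hac.ae_le husup
  rw [← hωu]
  set W := (ω univ).toReal with hW
  have hWof : ENNReal.ofReal W = ω univ := ofReal_toReal (measure_ne_top _ _)
  have hW0 : 0 ≤ W := toReal_nonneg
  set K := W ^ (1 - q) * b ^ q / (1 - q) with hK
  have hK0 : 0 ≤ K := by positivity
  have hkap : kappa G q (σ.restrict S) ≤ ENNReal.ofReal (K ^ (1 / q)) := by
    apply sInf_le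
    intro ν _
    set N := (ν univ).toReal with hN
    have hN0 : 0 ≤ N := toReal_nonneg
    have hNof : ENNReal.ofReal N = ν univ := ofReal_toReal (measure_ne_top _ _)
    have hst := strong ω (fun x => pot G ν x / u x) ((meas_pot hGk ν).div hu) q (b * N) hq0 hq1
      (by positivity) (by
        intro t ht
        rw [ofReal_mul hb.le, hNof]
        refine le_trans ?_ (weak_type hGk hsymm hWMP ω ?_ ν (ENNReal.ofReal t) ofReal_ne_top)
        · refine mul_le_mul_right ?_ _
          apply measure_mono_ae
          filter_upwards [hωsup] with x hx h
          have h : ENNReal.ofReal t < pot G ν x / u x := h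
          change ENNReal.ofReal t * pot G ω x < pot G ν x
          refine lt_of_le_of_lt ?_ (ENNReal.mul_lt_of_lt_div h)
          gcongr
          exact (hpot x).trans hx.1
        · filter_upwards [hωsup] with x hx
          exact ((hpot x).trans hx.1).trans_lt hx.2)
    have heq : ∫⁻ x, pot G ν x ^ q ∂(σ.restrict S) = ∫⁻ x, (pot G ν x / u x) ^ q ∂ω := by
      rw [hω2, lintegral_withDensity_eq_lintegral_mul _ huq
        (show Measurable fun x => (pot G ν x / u x) ^ q from
          ((meas_pot hGk ν).div hu).pow_const q)]
      apply lintegral_congr_ae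
      filter_upwards [ae_restrict_of_ae hupos, ae_restrict_of_ae husup] with x h1 h2
      rw [Pi.mul_apply, ← ENNReal.mul_rpow_of_nonneg _ _ hq0.le,
        ENNReal.mul_div_cancel h1.ne' h2.2.ne]
    unfold lqNorm
    rw [heq]
    calc _ ≤ (ENNReal.ofReal (W ^ (1 - q) * (b * N) ^ q / (1 - q))) ^ (1 / q) := by
          gcongr
      _ = ENNReal.ofReal ((K * N ^ q) ^ (1 / q)) := by
          rw [ENNReal.ofReal_rpow_of_nonneg (by positivity) (by positivity)]
          congr 2
          rw [Real.mul_rpow hb.le hN0, hK]; ring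
      _ = ENNReal.ofReal (K ^ (1 / q)) * ν univ := by
          rw [Real.mul_rpow hK0 (by positivity), ← Real.rpow_mul hN0, mul_one_div_cancel hq0.ne',
            Real.rpow_one, ofReal_mul (by positivity), hNof]
  calc _ ≤ ENNReal.ofReal ((1 - q) ^ ((1 : ℝ) / (1 - q)) * b ^ (-(q / (1 - q)))) *
        (ENNReal.ofReal (K ^ (1 / q))) ^ (q / (1 - q)) := by gcongr
    _ = ENNReal.ofReal ((1 - q) ^ ((1 : ℝ) / (1 - q)) * b ^ (-(q / (1 - q))) *
        K ^ (1 / (1 - q))) := by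
      rw [ENNReal.ofReal_rpow_of_nonneg (by positivity) (by positivity),
        ← ofReal_mul (by positivity), ← Real.rpow_mul hK0]
      congr 3
      field_simp
    _ = ENNReal.ofReal W := by
      congr 1
      rw [hK, Real.div_rpow (by positivity) hq1'.le, Real.mul_rpow (by positivity) (by positivity),
        ← Real.rpow_mul hW0, ← Real.rpow_mul hb.le, mul_one_div_cancel hq1'.ne', Real.rpow_one,
        Real.rpow_neg hb.le, mul_one_div]
      field_simp
    _ = _ := hWof

lemma lint_inv_sq (a : ℝ≥0∞) :
    ∫⁻ r in Ioi (0:ℝ), (if a⁻¹ < ENNReal.ofReal r then 1 / ENNReal.ofReal (r ^ 2) else 0) ≤ a := by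
  rcases eq_or_ne a ∞ with rfl | ha
  · exact le_top
  rcases eq_or_ne a 0 with rfl | ha0
  · simp
  have hp : 0 < a.toReal⁻¹ := inv_pos.2 (toReal_pos ha0 ha)
  have hinv : a⁻¹ = ENNReal.ofReal (a.toReal⁻¹) := by
    rw [ofReal_inv_of_pos (toReal_pos ha0 ha), ofReal_toReal ha]
  calc _ = ∫⁻ r in Ioi (0:ℝ), (Ioi a.toReal⁻¹).indicator
        (fun r : ℝ => ENNReal.ofReal (r ^ ((0 : ℝ) - 2))) r := by
        apply lintegral_congr_ae
        filter_upwards [ae_restrict_mem measurableSet_Ioi] with r hr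
        have hr : 0 < r := hr
        unfold indicator
        simp only [mem_Ioi, hinv, ofReal_lt_ofReal_iff hr]
        split_ifs with h
        · rw [one_div, ← ofReal_inv_of_pos (by positivity)]
          congr 1
          rw [zero_sub, Real.rpow_neg hr.le]
          norm_num
        · rfl
    _ = ∫⁻ r in Ioi a.toReal⁻¹, ENNReal.ofReal (r ^ ((0 : ℝ) - 2)) := by
        rw [lintegral_indicator measurableSet_Ioi, Measure.restrict_restrict measurableSet_Ioi]
        congr 2
        exact inter_eq_left.2 (Ioi_subset_Ioi hp.le)
    _ = a := by
        rw [lint_Ioi 0 _ one_pos hp, zero_sub, Real.rpow_neg hp.le]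
        simp [ofReal_toReal ha]
    _ ≤ a := le_rfl

/-- lower bound `u ≥ c Kσ`, with `c = (1-q)^{1/(1-q)} 𝔟^{-q/(1-q)}`, for
nontrivial super-solutions, for a symmetric kernel obeying the weak maximum principle. -/
theorem statement10 [LocallyCompactSpace Ω] [T2Space Ω] [SecondCountableTopology Ω]
    [BorelSpace Ω] (G : Ω → Ω → ℝ≥0∞) (q b : ℝ) (hq0 : 0 < q) (hq1 : q < 1)
    (σ : Measure Ω) [IsLocallyFiniteMeasure σ] (hGk : IsKernel G)
    (hsymm : ∀ x y, G x y = G y x) (hWMP : WMP G b)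
    (u : Ω → ℝ≥0∞) (hu : Measurable u) (hupos : ∀ᵐ x ∂σ, 0 < u x)
    (husup : ∀ᵐ x ∂σ, potF G σ (fun y => u y ^ q) x ≤ u x ∧ u x < ∞) :
    (∀ x : Ω, potF G σ (fun y => u y ^ q) x ≤ u x →
      ENNReal.ofReal ((1 - q) ^ ((1 : ℝ) / (1 - q)) * b ^ (-(q / (1 - q)))) *
          kpot G q σ x ≤ u x) ∧
    ∀ᵐ x ∂σ,
      ENNReal.ofReal ((1 - q) ^ ((1 : ℝ) / (1 - q)) * b ^ (-(q / (1 - q)))) *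
          kpot G q σ x ≤ u x := by
  have h1 : ∀ x : Ω, potF G σ (fun y => u y ^ q) x ≤ u x →
      ENNReal.ofReal ((1 - q) ^ ((1 : ℝ) / (1 - q)) * b ^ (-(q / (1 - q)))) *
          kpot G q σ x ≤ u x := by
    intro x hx
    refine le_trans ?_ hx
    have huq : Measurable (fun y => u y ^ q) := hu.pow_const q
    have hGx := meas_Gx hGk x
    have hballm : ∀ r, MeasurableSet (ball G x r) := fun r =>
      measurableSet_lt hGx.inv measurable_const
    unfold kpot
    rw [← lintegral_const_mul' _ _ ofReal_ne_top]
    have hmeas : Measurable (Function.uncurry fun (r : ℝ) (y : Ω) =>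
        (if (G x y)⁻¹ < ENNReal.ofReal r then 1 / ENNReal.ofReal (r ^ 2) else 0) * u y ^ q) := by
      refine Measurable.mul ?_ (huq.comp measurable_snd)
      refine Measurable.ite ?_ ?_ measurable_const
      · exact measurableSet_lt (hGx.inv.comp measurable_snd)
          (ENNReal.measurable_ofReal.comp measurable_fst)
      · exact measurable_const.div
          (ENNReal.measurable_ofReal.comp (measurable_fst.pow_const 2))
    calc _ ≤ ∫⁻ r in Ioi (0:ℝ), ∫⁻ y, (if (G x y)⁻¹ < ENNReal.ofReal r then
            1 / ENNReal.ofReal (r ^ 2) else 0) * u y ^ q ∂σ := by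
          apply lintegral_mono
          intro r
          dsimp only
          rw [← mul_div_assoc]
          calc _ ≤ (σ.withDensity (fun y => u y ^ q)) (ball G x r) / ENNReal.ofReal (r ^ 2) := by
                gcongr
                exact ball_est G q b hq0 hq1 σ hGk hsymm hWMP u hu hupos husup _ (hballm r)
            _ = _ := by
                rw [withDensity_apply _ (hballm r), ← lintegral_indicator (hballm r),
                  div_eq_mul_inv, ← lintegral_mul_const _ (huq.indicator (hballm r))]
                apply lintegral_congr
                intro y
                unfold indicator ball
                simp only [mem_ofPred_eq]
                split_ifs
                · rw [one_div, mul_comm]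
                · simp
      _ = ∫⁻ y, (∫⁻ r in Ioi (0:ℝ), (if (G x y)⁻¹ < ENNReal.ofReal r then
            1 / ENNReal.ofReal (r ^ 2) else 0) * u y ^ q) ∂σ :=
          lintegral_lintegral_swap hmeas.aemeasurable
      _ ≤ _ := by
          unfold potF
          apply lintegral_mono
          intro y
          dsimp only
          rw [lintegral_mul_const]
          · gcongr
            exact lint_inv_sq _
          · refine Measurable.ite ?_ ?_ measurable_const
            · exact measurableSet_lt measurable_const ENNReal.measurable_ofReal
            · exact measurable_const.div
                (ENNReal.measurable_ofReal.comp (measurable_id.pow_const 2))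
  refine ⟨h1, ?_⟩
  filter_upwards [husup] with x hx using h1 x hx.1

end NPE
end
end

section
/- Let Ω be a locally compact Hausdorff space with countable base, 0 < q < 1, μ and σ locally finite Radon measures on Ω with σ ≠ 0, and G a quasi-metric kernel on Ω. Then the following three conditions are equivalent: (i) Gσ < +∞, Kσ < +∞, and Gμ < +∞ σ-a.e. in Ω; (ii) Gσ ≢ +∞, Kσ ≢ +∞, and Gμ ≢ +∞ on Ω; (iii) for some (equivalently, all) x₀ ∈ Ω and a > 0, ∫_a^∞ σ(B(x₀,r)) r^{−2} dr < ∞, ∫_a^∞ [ϰ(B(x₀,r))]^{q/(1−q)} r^{−2} dr < ∞, and ∫_a^∞ μ(B(x₀,r)) r^{−2} dr < ∞. -/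
open MeasureTheory ENNReal Set

noncomputable section

namespace NPE

variable {Ω : Type*} [TopologicalSpace Ω] [MeasurableSpace Ω]

section helpers

set_option linter.unusedSectionVars false

lemma kappa_mono (G : Ω → Ω → ℝ≥0∞) {q : ℝ} (hq : 0 < q) {σ τ : Measure Ω} (h : σ ≤ τ) :
    kappa G q σ ≤ kappa G q τ := by
  refine sInf_le_sInf fun C hC ν hν => le_trans ?_ (hC ν hν)
  unfold lqNorm
  exact ENNReal.rpow_le_rpow (lintegral_mono' h le_rfl) (by positivity)

lemma ball_mono (G : Ω → Ω → ℝ≥0∞) (x : Ω) {r s : ℝ} (h : r ≤ s) : ball G x r ⊆ ball G x s :=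
  fun _ hy => lt_of_lt_of_le hy (ENNReal.ofReal_le_ofReal h)

lemma lint_Ioi_s16 {b : ℝ} (hb : 0 < b) :
    ∫⁻ r in Ioi b, (ENNReal.ofReal (r ^ 2))⁻¹ = (ENNReal.ofReal b)⁻¹ := by
  have h1 : IntegrableOn (fun r : ℝ => r ^ (-2 : ℝ)) (Ioi b) :=
    integrableOn_Ioi_rpow_of_lt (by norm_num) hb
  have h2 : ∫ r in Ioi b, r ^ (-2 : ℝ) = b⁻¹ := by
    rw [integral_Ioi_rpow_of_lt (by norm_num) hb]
    norm_num [Real.rpow_neg_one]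
  have h3 : ∫⁻ r in Ioi b, (ENNReal.ofReal (r ^ 2))⁻¹
      = ∫⁻ r in Ioi b, ENNReal.ofReal (r ^ (-2 : ℝ)) := by
    refine setLIntegral_congr_fun measurableSet_Ioi fun r hr => ?_
    have hr' : 0 < r := hb.trans hr
    rw [Real.rpow_neg hr'.le, ENNReal.ofReal_inv_of_pos (by positivity)]
    norm_num
  rw [h3, ← ofReal_integral_eq_lintegral_ofReal h1, h2, ENNReal.ofReal_inv_of_pos hb]
  filter_upwards [ae_restrict_mem measurableSet_Ioi] with r hr
  have hr' : 0 < r := hb.trans hr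
  simp only [Pi.zero_apply]; positivity

lemma lint_layer (g : ℝ≥0∞) (hg : 0 < g) :
    ∫⁻ r in Ioi (0:ℝ), (if g⁻¹ < ENNReal.ofReal r then (1:ℝ≥0∞) else 0) / ENNReal.ofReal (r ^ 2)
      = g := by
  have hfun : ∀ r : ℝ, (if g⁻¹ < ENNReal.ofReal r then (1:ℝ≥0∞) else 0) / ENNReal.ofReal (r ^ 2)
      = (Ioi (g⁻¹).toReal).indicator (fun r : ℝ => (ENNReal.ofReal (r ^ 2))⁻¹) r := by
    intro r
    have hfin : g⁻¹ ≠ ∞ := ENNReal.inv_ne_top.2 hg.ne'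
    by_cases h : g⁻¹ < ENNReal.ofReal r
    · rw [if_pos h, indicator_of_mem, one_div]
      exact (ENNReal.lt_ofReal_iff_toReal_lt hfin).1 h
    · rw [if_neg h, indicator_of_notMem]
      · simp
      · exact fun h' => h ((ENNReal.lt_ofReal_iff_toReal_lt hfin).2 h')
  simp_rw [hfun]
  rw [setLIntegral_indicator measurableSet_Ioi,
    inter_eq_left.2 (Ioi_subset_Ioi ENNReal.toReal_nonneg)]
  by_cases h : g = ∞
  · subst h
    simp only [ENNReal.inv_top, ENNReal.toReal_zero]
    refine ENNReal.eq_top_of_forall_nnreal_le fun c => ?_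
    have hc : (0:ℝ) < (c + 1 : ℝ)⁻¹ := by positivity
    calc (c : ℝ≥0∞) ≤ (ENNReal.ofReal (c + 1 : ℝ)⁻¹)⁻¹ := by
          rw [ENNReal.ofReal_inv_of_pos (by positivity), inv_inv,
            ENNReal.ofReal_add (by positivity) (by positivity)]
          simp
      _ = _ := (lint_Ioi_s16 hc).symm
      _ ≤ _ := lintegral_mono_set (Ioi_subset_Ioi hc.le)
  · rw [lint_Ioi_s16 (ENNReal.toReal_pos (by simpa using h) (by simpa using hg.ne')),
      ENNReal.ofReal_toReal (by simpa using hg.ne'), inv_inv]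

lemma lint_scale (f : ℝ → ℝ≥0∞) {c : ℝ} (hc : 0 < c) :
    ∫⁻ r, f r = ENNReal.ofReal c * ∫⁻ r, f (c * r) := by
  have h := Real.smul_map_volume_mul_left hc.ne'
  have e : MeasurableEmbedding (fun r : ℝ => c * r) :=
    (Homeomorph.mulLeft₀ c hc.ne').measurableEmbedding
  conv_lhs => rw [← h]
  rw [lintegral_smul_measure, abs_of_pos hc, smul_eq_mul]
  congr 1
  exact e.lintegral_map f

lemma scale_le (F : ℝ → ℝ≥0∞) {a b c : ℝ} (hc : 0 < c) (ha : 0 ≤ a) (hb : b ≤ c * a) :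
    ∫⁻ r in Ioi a, F (c * r) / ENNReal.ofReal (r ^ 2)
      ≤ ENNReal.ofReal c * ∫⁻ r in Ioi b, F r / ENNReal.ofReal (r ^ 2) := by
  rw [← lintegral_indicator measurableSet_Ioi, ← lintegral_indicator measurableSet_Ioi,
    lint_scale ((Ioi b).indicator _) hc, ← mul_assoc, ← lintegral_const_mul' _ _ (by finiteness)]
  refine lintegral_mono fun r => ?_
  by_cases h : r ∈ Ioi a
  · have h' : c * r ∈ Ioi b := hb.trans_lt ((mul_lt_mul_iff_right₀ hc).2 h)
    have hr : 0 < r := ha.trans_lt h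
    rw [indicator_of_mem h, indicator_of_mem h']
    rw [mul_pow, ENNReal.ofReal_mul (by positivity), ENNReal.div_eq_inv_mul,
      ENNReal.div_eq_inv_mul, ENNReal.mul_inv (by simp) (by simp), ← mul_assoc,
      ← mul_assoc, ← ENNReal.ofReal_mul hc.le, ← pow_two, ENNReal.mul_inv_cancel
        (by simp; positivity) (by simp), one_mul]
  · rw [indicator_of_notMem h]; exact zero_le

/-- Tail integral. -/
def tl (G : Ω → Ω → ℝ≥0∞) (F : Set Ω → ℝ≥0∞) (x : Ω) (a : ℝ) : ℝ≥0∞ :=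
  ∫⁻ r in Set.Ioi a, F (ball G x r) / ENNReal.ofReal (r ^ 2)

lemma qm_lt {G : Ω → Ω → ℝ≥0∞} {κ : ℝ} (hG : IsQuasiMetricKernel G κ) {x y z : Ω} {r s : ℝ}
    (hr : 0 < r) (hs : 0 < s)
    (h1 : (G x z)⁻¹ < ENNReal.ofReal r) (h2 : (G z y)⁻¹ < ENNReal.ofReal s) :
    (G x y)⁻¹ < ENNReal.ofReal (κ * (r + s)) := by
  obtain ⟨-, hκ, -, -, h⟩ := hG
  have hκ0 : 0 < κ := by linarith
  refine (h x y z).trans_lt ?_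
  rw [ENNReal.ofReal_mul hκ0.le, ENNReal.ofReal_add hr.le hs.le]
  exact ENNReal.mul_lt_mul_right (by simpa using hκ0) (by simp) (ENNReal.add_lt_add h1 h2)

lemma tl_transfer {G : Ω → Ω → ℝ≥0∞} {κ : ℝ} (hG : IsQuasiMetricKernel G κ)
    {F : Set Ω → ℝ≥0∞} (hF : Monotone F) {x₀ : Ω} {a₀ : ℝ} (h : tl G F x₀ a₀ < ∞)
    (x₁ : Ω) {a₁ : ℝ} (ha₁ : 0 < a₁) : tl G F x₁ a₁ < ∞ := by
  have hκ : 0 < κ := by linarith [hG.2.1]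
  obtain ⟨R, hR0, hR⟩ : ∃ R : ℝ, 0 < R ∧ (G x₀ x₁)⁻¹ < ENNReal.ofReal R := by
    have : (G x₀ x₁)⁻¹ ≠ ∞ := ENNReal.inv_ne_top.2 (hG.2.2.1 _ _).ne'
    refine ⟨(G x₀ x₁)⁻¹.toReal + 1, by positivity, ?_⟩
    rw [ENNReal.lt_ofReal_iff_toReal_lt this]; linarith
  set c := max (κ * (1 + R / a₁)) (a₀ / a₁)
  have hc : 0 < c := lt_max_of_lt_left (by positivity)
  have hca : a₀ ≤ c * a₁ := by
    rw [← div_le_iff₀ ha₁]; exact le_max_right _ _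
  refine lt_of_le_of_lt ?_ (ENNReal.mul_lt_top (ENNReal.ofReal_lt_top (r := c)) h)
  refine le_trans ?_ (scale_le (fun r => F (ball G x₀ r)) hc ha₁.le hca)
  refine setLIntegral_mono' measurableSet_Ioi fun r hr => ?_
  have hr0 : 0 < r := ha₁.trans hr
  refine ENNReal.div_le_div_right (hF fun y hy => ?_) _
  refine (qm_lt hG hR0 hr0 hR hy).trans_le (ENNReal.ofReal_le_ofReal ?_)
  have h1 : R ≤ R / a₁ * r := by
    rw [div_mul_eq_mul_div, le_div_iff₀ ha₁]; exact mul_le_mul_of_nonneg_left (le_of_lt hr) hR0.le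
  calc κ * (R + r) ≤ κ * (1 + R / a₁) * r := by
        rw [mul_assoc]; refine mul_le_mul_of_nonneg_left ?_ hκ.le; linarith
    _ ≤ c * r := mul_le_mul_of_nonneg_right (le_max_left _ _) hr0.le

lemma tl_fin {G : Ω → Ω → ℝ≥0∞}
    {F : Set Ω → ℝ≥0∞} (hF : Monotone F) {x₀ : Ω} {a₀ : ℝ} (ha : 0 < a₀) (h : tl G F x₀ a₀ < ∞) :
    F (ball G x₀ a₀) < ∞ := by
  by_contra hcon
  have htop : F (ball G x₀ a₀) = ∞ := by simpa using hcon
  have : ∞ * (ENNReal.ofReal a₀)⁻¹ ≤ tl G F x₀ a₀ := by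
    rw [← lint_Ioi_s16 ha, ← lintegral_const_mul _ (by fun_prop), tl]
    refine setLIntegral_mono' measurableSet_Ioi fun r hr => ?_
    rw [← htop, div_eq_mul_inv]
    gcongr
    exact hF (ball_mono G x₀ (le_of_lt hr))
  rw [ENNReal.top_mul (by simp)] at this
  exact absurd h (not_lt.2 this)

variable [SecondCountableTopology Ω] [BorelSpace Ω]

lemma G_meas2 {G : Ω → Ω → ℝ≥0∞} {κ : ℝ} (hG : IsQuasiMetricKernel G κ) :
    Measurable (fun p : Ω × Ω => G p.1 p.2) :=
  LowerSemicontinuous.measurable hG.1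

lemma G_meas {G : Ω → Ω → ℝ≥0∞} {κ : ℝ} (hG : IsQuasiMetricKernel G κ) (x : Ω) :
    Measurable (G x) :=
  (G_meas2 hG).comp (measurable_const.prodMk measurable_id)

lemma pot_meas {G : Ω → Ω → ℝ≥0∞} {κ : ℝ} (hG : IsQuasiMetricKernel G κ) (ν : Measure Ω)
    [SFinite ν] : Measurable (pot G ν) :=
  (G_meas2 hG).lintegral_prod_right'

lemma ball_open {G : Ω → Ω → ℝ≥0∞} {κ : ℝ} (hG : IsQuasiMetricKernel G κ) (x : Ω) (r : ℝ) :
    IsOpen (ball G x r) := by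
  have h1 : LowerSemicontinuous (G x) := by
    have := hG.1
    exact LowerSemicontinuous.comp this (g := fun y => (x, y)) (by fun_prop)
  have : ball G x r = (G x) ⁻¹' (Ioi (ENNReal.ofReal r)⁻¹) := by
    ext y
    simp only [ball, mem_ofPred_eq, mem_preimage, mem_Ioi]
    rw [ENNReal.inv_lt_iff_inv_lt]
  rw [this]
  exact h1.isOpen_preimage _

lemma ball_meas {G : Ω → Ω → ℝ≥0∞} {κ : ℝ} (hG : IsQuasiMetricKernel G κ) (x : Ω) (r : ℝ) :
    MeasurableSet (ball G x r) := (ball_open hG x r).measurableSet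

lemma pot_eq {G : Ω → Ω → ℝ≥0∞} {κ : ℝ} (hG : IsQuasiMetricKernel G κ) (ν : Measure Ω)
    [SFinite ν] (x : Ω) : pot G ν x = tl G (fun s => ν s) x 0 := by
  unfold pot tl
  have hm : Measurable (fun p : ℝ × Ω => (if (G x p.2)⁻¹ < ENNReal.ofReal p.1
      then (1:ℝ≥0∞) else 0) / ENNReal.ofReal (p.1 ^ 2)) := by
    have := (G_meas hG x)
    refine Measurable.div (Measurable.ite (measurableSet_lt ?_ ?_) ?_ ?_) ?_ <;> fun_prop
  calc ∫⁻ y, G x y ∂ν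
      = ∫⁻ y, ∫⁻ r in Ioi (0:ℝ), (if (G x y)⁻¹ < ENNReal.ofReal r then (1:ℝ≥0∞) else 0)
          / ENNReal.ofReal (r ^ 2) ∂volume ∂ν :=
        lintegral_congr fun y => (lint_layer _ (hG.2.2.1 x y)).symm
    _ = ∫⁻ r in Ioi (0:ℝ), ∫⁻ y, (if (G x y)⁻¹ < ENNReal.ofReal r then (1:ℝ≥0∞) else 0)
          / ENNReal.ofReal (r ^ 2) ∂ν :=
        lintegral_lintegral_swap (f := fun y r => (if (G x y)⁻¹ < ENNReal.ofReal r
          then (1:ℝ≥0∞) else 0) / ENNReal.ofReal (r ^ 2)) (hm.comp measurable_swap).aemeasurable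
    _ = _ := by
        refine setLIntegral_congr_fun measurableSet_Ioi fun r hr => ?_
        have hr : 0 < r := hr
        simp only [div_eq_mul_inv]
        rw [lintegral_mul_const' _ _ (by simp; positivity)]
        congr 1
        rw [← lintegral_indicator_one (ball_meas hG x r)]
        refine lintegral_congr fun y => ?_
        by_cases h : y ∈ ball G x r
        · rw [indicator_of_mem h, if_pos (show (G x y)⁻¹ < ENNReal.ofReal r from h)]; rfl
        · rw [indicator_of_notMem h, if_neg (show ¬ (G x y)⁻¹ < ENNReal.ofReal r from h)]

lemma tl_split (G : Ω → Ω → ℝ≥0∞) (F : Set Ω → ℝ≥0∞) (x : Ω) {a : ℝ} (ha : 0 < a) :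
    tl G F x 0 = (∫⁻ r in Ioc 0 a, F (ball G x r) / ENNReal.ofReal (r ^ 2)) + tl G F x a := by
  unfold tl
  rw [← Ioc_union_Ioi_eq_Ioi ha.le, lintegral_union measurableSet_Ioi (Ioc_disjoint_Ioi le_rfl)]

/-- weak type estimate -/
lemma weak_type_s16 {G : Ω → Ω → ℝ≥0∞} {κ : ℝ} (hG : IsQuasiMetricKernel G κ) (ν ω : Measure Ω)
    [IsFiniteMeasure ν] [SFinite ω] {τ : ℝ≥0∞} (h0 : τ ≠ 0) (htop : τ ≠ ∞) :
    τ * ω {x | τ * ENNReal.ofReal (3 * κ) * pot G ω x < pot G ν x} ≤ ν univ := by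
  have hκ : 0 < κ := by linarith [hG.2.1]
  set c := 3 * κ with hc
  have hc0 : 0 < c := by positivity
  let E : ℕ → Set Ω := fun n => {x | ∃ r : ℝ, 0 < r ∧ r ≤ n ∧
    τ * ω (ball G x (c * r)) < ν (ball G x r)}
  have hE : ∀ n, τ * ω (E n) ≤ ν univ := by
    intro n
    let t : Set (Ω × ℝ) := {p | 0 < p.2 ∧ p.2 ≤ n ∧
      τ * ω (ball G p.1 (c * p.2)) < ν (ball G p.1 p.2)}
    have hne : ∀ p ∈ t, (ball G p.1 p.2).Nonempty := by
      intro p hp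
      by_contra hcon
      rw [not_nonempty_iff_eq_empty] at hcon
      have := hp.2.2
      rw [hcon] at this
      simp at this
    obtain ⟨u, hut, hdis, hcov⟩ := Vitali.exists_disjoint_subfamily_covering_enlargement
      (fun p : Ω × ℝ => ball G p.1 p.2) t (fun p => p.2) 2 (by norm_num)
      (fun p hp => hp.1.le) n (fun p hp => hp.2.1) hne
    have hcount : u.Countable :=
      hdis.countable_of_isOpen (fun p _ => ball_open hG _ _) (fun p hp => hne p (hut hp))
    have hsub : E n ⊆ ⋃ p ∈ u, ball G p.1 (c * p.2) := by
      rintro x ⟨r, hr0, hrn, hr⟩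
      obtain ⟨p, hpu, ⟨z, hz1, hz2⟩, hp2⟩ := hcov (x, r) ⟨hr0, hrn, hr⟩
      simp only at hz1 hz2 hp2
      refine mem_biUnion hpu ?_
      have hz1' : (G z x)⁻¹ < ENNReal.ofReal r := by
        rw [hG.2.2.2.1 z x]; exact hz1
      refine (qm_lt hG (hut hpu).1 hr0 hz2 hz1').trans_le (ENNReal.ofReal_le_ofReal ?_)
      rw [hc]; nlinarith
    calc τ * ω (E n) ≤ τ * ∑' p : u, ω (ball G p.1.1 (c * p.1.2)) := by
          gcongr
          exact (measure_mono hsub).trans (measure_biUnion_le ω hcount _)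
      _ = ∑' p : u, τ * ω (ball G p.1.1 (c * p.1.2)) := ENNReal.tsum_mul_left.symm
      _ ≤ ∑' p : u, ν (ball G p.1.1 p.1.2) := ENNReal.tsum_le_tsum fun p => (hut p.2).2.2.le
      _ = ν (⋃ p ∈ u, ball G p.1 p.2) :=
          (measure_biUnion hcount hdis fun p _ => ball_meas hG _ _).symm
      _ ≤ ν univ := measure_mono (subset_univ _)
  have hEm : Monotone E := by
    rintro m n hmn x ⟨r, h1, h2, h3⟩
    exact ⟨r, h1, h2.trans (by exact_mod_cast hmn), h3⟩
  have hsub : {x | τ * ENNReal.ofReal c * pot G ω x < pot G ν x} ⊆ ⋃ n, E n := by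
    intro x hx
    by_contra hcon
    simp only [E, mem_iUnion, mem_ofPred_eq, not_exists, not_and, not_lt] at hcon
    have key : ∀ r : ℝ, 0 < r → ν (ball G x r) ≤ τ * ω (ball G x (c * r)) := by
      intro r hr
      obtain ⟨n, hn⟩ := exists_nat_ge r
      exact hcon n r hr hn
    refine absurd (show τ * ENNReal.ofReal c * pot G ω x < pot G ν x from hx) (not_lt.2 ?_)
    rw [pot_eq hG, pot_eq hG, mul_assoc]
    refine le_trans ?_ (mul_le_mul_right
      (scale_le (fun r => ω (ball G x r)) (a := 0) (b := 0) hc0 le_rfl (by simp)) τ)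
    rw [← lintegral_const_mul' _ _ htop]
    refine setLIntegral_mono' measurableSet_Ioi fun r hr => ?_
    rw [← mul_div_assoc]
    exact ENNReal.div_le_div_right (key r hr) _
  calc τ * ω _ ≤ τ * ω (⋃ n, E n) := by gcongr
    _ = ⨆ n, τ * ω (E n) := by rw [hEm.measure_iUnion, ENNReal.mul_iSup]
    _ ≤ ν univ := iSup_le hE

/-- Kolmogorov type estimate constant. -/
def Dq (q : ℝ) : ℝ≥0∞ := 1 + ∑' k : ℕ, (2:ℝ≥0∞) ^ q * ((2:ℝ≥0∞) ^ (q - 1)) ^ k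

lemma Dq_lt {q : ℝ} (hq1 : q < 1) : Dq q < ∞ := by
  unfold Dq
  rw [ENNReal.tsum_mul_left, ENNReal.tsum_geometric]
  refine ENNReal.add_lt_top.2 ⟨by simp, ENNReal.mul_lt_top ?_ ?_⟩
  · exact (ENNReal.rpow_ne_top_of_ne_zero (by simp) (by simp)).lt_top
  · rw [ENNReal.inv_lt_top, tsub_pos_iff_lt]
    exact ENNReal.rpow_lt_one_of_one_lt_of_neg (by norm_num) (by linarith)

lemma kolmo_pt {q : ℝ} (hq0 : 0 < q) (f s : ℝ≥0∞) (hs0 : s ≠ 0) (hs : s ≠ ∞) :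
    f ^ q ≤ s ^ q + ∑' k : ℕ, (2 ^ (k + 1) * s) ^ q * (if 2 ^ k * s < f then 1 else 0) := by
  by_cases hfs : f ≤ s
  · exact (ENNReal.rpow_le_rpow hfs hq0.le).trans le_self_add
  refine le_trans ?_ le_add_self
  push Not at hfs
  have hex : f ≠ ∞ → ∃ n : ℕ, f ≤ 2 ^ n * s := by
    intro hf
    obtain ⟨n, hn⟩ := ENNReal.exists_nat_mul_gt hs0 hf
    refine ⟨n, hn.le.trans ?_⟩
    gcongr
    exact_mod_cast Nat.lt_two_pow_self.le
  by_cases hf : f = ∞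
  · subst hf
    have : ∀ k : ℕ, s ^ q ≤ (2 ^ (k + 1) * s) ^ q * (if 2 ^ k * s < ∞ then 1 else 0) := by
      intro k
      rw [if_pos (ENNReal.mul_lt_top (by finiteness) hs.lt_top), mul_one]
      refine ENNReal.rpow_le_rpow ?_ hq0.le
      exact le_mul_of_one_le_left zero_le (one_le_pow₀ (by norm_num))
    refine le_trans (le_of_eq ?_) (ENNReal.tsum_le_tsum this)
    rw [ENNReal.tsum_const_eq_top_of_ne_zero, ENNReal.top_rpow_of_pos hq0]
    exact (ENNReal.rpow_pos (pos_iff_ne_zero.2 hs0) hs).ne'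
  · classical
    have hex := hex hf
    have hn := Nat.find_spec hex
    have hm := fun m => Nat.find_min hex (m := m)
    rcases h : Nat.find hex with _ | k
    · rw [h] at hn; simp at hn; exact absurd hfs (not_lt.2 hn)
    · rw [h] at hn
      have hk := hm k (by omega)
      push Not at hk
      refine le_trans ?_ (ENNReal.le_tsum k)
      rw [if_pos hk, mul_one]
      exact ENNReal.rpow_le_rpow hn hq0.le

lemma kolmo {q : ℝ} (hq0 : 0 < q) (ω : Measure Ω) {f : Ω → ℝ≥0∞} (hf : Measurable f)
    {s : ℝ≥0∞} (hs0 : s ≠ 0) (hs : s ≠ ∞)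
    (h : ∀ k : ℕ, 2 ^ k * ω {x | 2 ^ k * s < f x} ≤ ω univ) :
    ∫⁻ x, f x ^ q ∂ω ≤ Dq q * s ^ q * ω univ := by
  have hme : ∀ k : ℕ, MeasurableSet {x | 2 ^ k * s < f x} := fun k =>
    measurableSet_lt measurable_const hf
  calc ∫⁻ x, f x ^ q ∂ω ≤ ∫⁻ x, (s ^ q + ∑' k : ℕ, (2 ^ (k + 1) * s) ^ q *
        (if 2 ^ k * s < f x then 1 else 0)) ∂ω := lintegral_mono fun x => kolmo_pt hq0 _ _ hs0 hs
    _ = s ^ q * ω univ + ∑' k : ℕ, (2 ^ (k + 1) * s) ^ q * ω {x | 2 ^ k * s < f x} := by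
        rw [lintegral_add_left measurable_const, lintegral_const, lintegral_tsum]
        · congr 1
          refine tsum_congr fun k => ?_
          rw [lintegral_const_mul _ (Measurable.ite (hme k) measurable_const measurable_const),
            ← lintegral_indicator_one (hme k)]
          congr 1
          refine lintegral_congr fun x => ?_
          by_cases h : x ∈ {x | 2 ^ k * s < f x}
          · rw [indicator_of_mem h, if_pos (show 2 ^ k * s < f x from h)]; rfl
          · rw [indicator_of_notMem h, if_neg (show ¬ 2 ^ k * s < f x from h)]
        · intro k
          exact ((Measurable.ite (hme k) measurable_const measurable_const).const_mul _).aemeasurable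
    _ ≤ s ^ q * ω univ + ∑' k : ℕ, ((2:ℝ≥0∞) ^ q * ((2:ℝ≥0∞) ^ (q - 1)) ^ k)
          * (s ^ q * ω univ) := by
        refine add_le_add le_rfl (ENNReal.tsum_le_tsum fun k => ?_)
        have h2 : ω {x | 2 ^ k * s < f x} ≤ (2 ^ k)⁻¹ * ω univ := by
          rw [mul_comm _ (ω univ), ← div_eq_mul_inv, ENNReal.le_div_iff_mul_le (by simp) (by simp), mul_comm]
          exact h k
        calc _ ≤ (2 ^ (k + 1) * s) ^ q * ((2 ^ k)⁻¹ * ω univ) := mul_le_mul_right h2 _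
          _ = _ := by
            rw [ENNReal.mul_rpow_of_nonneg _ _ hq0.le, pow_succ',
              ENNReal.mul_rpow_of_nonneg _ _ hq0.le, ENNReal.rpow_sub _ _ (by simp) (by simp),
              ENNReal.rpow_one, ENNReal.div_eq_inv_mul, mul_pow, ← ENNReal.inv_pow,
              ← ENNReal.rpow_natCast (2 ^ q), ← ENNReal.rpow_natCast 2, ← ENNReal.rpow_mul,
              ← ENNReal.rpow_mul, mul_comm q (k:ℝ)]
            ring
    _ = _ := by rw [ENNReal.tsum_mul_right, Dq]; ring

lemma kappa_attained {G : Ω → Ω → ℝ≥0∞} {q : ℝ} (hq0 : 0 < q) {σ : Measure Ω}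
    (h : kappa G q σ < ∞) : ∃ C : ℝ≥0∞, C < ∞ ∧ ∀ ν : Measure Ω, IsFiniteMeasure ν →
      ∫⁻ x, pot G ν x ^ q ∂σ ≤ (C * ν univ) ^ q := by
  obtain ⟨C, hC, hlt⟩ := sInf_lt_iff.1 h
  refine ⟨C, hlt, fun ν hν => ?_⟩
  have := ENNReal.rpow_le_rpow (hC ν hν) hq0.le
  rwa [lqNorm, ← ENNReal.rpow_mul, one_div_mul_cancel hq0.ne', ENNReal.rpow_one] at this

lemma exists_a {q : ℝ} (hq1 : q < 1) {S K : ℝ≥0∞} (hS : S < ∞) (hK : K < ∞) :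
    ∃ a : ℝ≥0∞, a < ∞ ∧ S + K * a ^ q ≤ a := by
  have h1 : 0 < 1 - q := by linarith
  have hfin : (2 * K) ^ (1 / (1 - q)) < ∞ :=
    ENNReal.rpow_lt_top_of_nonneg (by positivity) (by finiteness)
  obtain ⟨a, ha⟩ : ∃ a, a = 2 * S + (2 * K) ^ (1 / (1 - q)) + 1 := ⟨_, rfl⟩
  have hat : a < ∞ := by rw [ha]; finiteness
  have ha0 : a ≠ 0 := by rw [ha]; simp
  refine ⟨a, hat, ?_⟩
  have h2 : 2 * S ≤ a := by rw [ha, add_assoc]; exact le_self_add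
  have h3 : 2 * K ≤ a ^ (1 - q) := by
    have : (2 * K) ^ (1 / (1 - q)) ≤ a := by
      rw [ha, add_assoc]; exact le_add_left le_self_add
    have := ENNReal.rpow_le_rpow this h1.le
    rwa [← ENNReal.rpow_mul, one_div_mul_cancel h1.ne', ENNReal.rpow_one] at this
  have h4 : 2 * (K * a ^ q) ≤ a := by
    calc 2 * (K * a ^ q) = (2 * K) * a ^ q := by ring
      _ ≤ a ^ (1 - q) * a ^ q := by gcongr
      _ = a := by rw [← ENNReal.rpow_add _ _ ha0 hat.ne]; simp
  have h5 : 2 * (S + K * a ^ q) ≤ 2 * a := by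
    rw [mul_add, two_mul a]; exact add_le_add h2 h4
  exact (ENNReal.mul_le_mul_iff_right (by simp) (by simp)).1 h5

/-- iteration -/
def itW (G : Ω → Ω → ℝ≥0∞) (q : ℝ) (σ : Measure Ω) : ℕ → Ω → ℝ≥0∞
  | 0 => fun _ => 0
  | n + 1 => fun x => 1 + pot G (σ.withDensity (itW G q σ n)) x ^ q

lemma supersol {G : Ω → Ω → ℝ≥0∞} {κ : ℝ} (hG : IsQuasiMetricKernel G κ) {q : ℝ} (hq0 : 0 < q)
    (hq1 : q < 1) {σ : Measure Ω} [IsFiniteMeasure σ] (h : kappa G q σ < ∞) :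
    ∃ w : Ω → ℝ≥0∞, Measurable w ∧ (∀ x, 1 ≤ w x) ∧ ∫⁻ x, w x ∂σ < ∞ ∧
      ∀ x, pot G (σ.withDensity w) x ≤ w x ^ (1 / q) := by
  obtain ⟨C, hC, hCν⟩ := kappa_attained hq0 h
  obtain ⟨a, ha, haS⟩ := exists_a hq1 (S := σ univ) (K := C ^ q) (measure_lt_top _ _)
    (ENNReal.rpow_lt_top_of_nonneg hq0.le hC.ne)
  set W := itW G q σ with hW
  have hWs : ∀ n x, W (n + 1) x = 1 + pot G (σ.withDensity (W n)) x ^ q := fun n x => rfl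
  have hmeas : ∀ n, Measurable (W n) := by
    intro n
    cases n with
    | zero => exact measurable_const
    | succ n => exact measurable_const.add ((pot_meas hG _).pow_const q)
  have hpot : ∀ (f : Ω → ℝ≥0∞), Measurable f → ∀ x,
      pot G (σ.withDensity f) x = ∫⁻ y, f y * G x y ∂σ := by
    intro f hf x
    rw [pot, lintegral_withDensity_eq_lintegral_mul _ hf (G_meas hG x)]; rfl
  have hmono1 : ∀ n x, W n x ≤ W (n + 1) x := by
    intro n
    induction n with
    | zero => intro x; exact zero_le
    | succ n ih =>
      intro x
      rw [hWs (n + 1), hWs n, hpot _ (hmeas _), hpot _ (hmeas _)]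
      refine add_le_add le_rfl (ENNReal.rpow_le_rpow (lintegral_mono fun y => ?_) hq0.le)
      exact mul_le_mul_left (ih y) _
  have hmono : Monotone W := monotone_nat_of_le_succ fun n x => hmono1 n x
  have hint : ∀ n, ∫⁻ x, W n x ∂σ ≤ a := by
    intro n
    induction n with
    | zero => simp [hW, itW]
    | succ n ih =>
      have hfin : IsFiniteMeasure (σ.withDensity (W n)) :=
        isFiniteMeasure_withDensity (ih.trans_lt ha).ne
      simp_rw [hWs]
      rw [lintegral_add_left measurable_const, lintegral_const, one_mul]
      refine le_trans (add_le_add le_rfl ((hCν _ hfin).trans ?_)) haS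
      rw [withDensity_apply _ MeasurableSet.univ, Measure.restrict_univ,
        ENNReal.mul_rpow_of_nonneg _ _ hq0.le]
      exact mul_le_mul_right (ENNReal.rpow_le_rpow ih hq0.le) _
  have hwm : Measurable (fun x => ⨆ n, W n x) := Measurable.iSup hmeas
  refine ⟨fun x => ⨆ n, W n x, hwm, ?_, ?_, ?_⟩
  · intro x
    refine le_trans ?_ (le_iSup (fun n => W n x) 1)
    rw [hWs]; exact le_self_add
  · rw [lintegral_iSup hmeas hmono]
    exact (iSup_le hint).trans_lt ha
  · intro x
    rw [hpot _ hwm]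
    simp_rw [ENNReal.iSup_mul]
    rw [lintegral_iSup (f := fun n y => W n y * G x y) (fun n => (hmeas n).mul (G_meas hG x))
      (fun m n hmn y => mul_le_mul_left (hmono hmn y) _)]
    refine iSup_le fun n => ?_
    rw [← hpot _ (hmeas n)]
    calc pot G (σ.withDensity (W n)) x = (pot G (σ.withDensity (W n)) x ^ q) ^ (1 / q) := by
          rw [← ENNReal.rpow_mul, mul_one_div_cancel hq0.ne', ENNReal.rpow_one]
      _ ≤ (W (n + 1) x) ^ (1 / q) :=
          ENNReal.rpow_le_rpow (by rw [hWs]; exact le_add_self) (by positivity)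
      _ ≤ _ := ENNReal.rpow_le_rpow (le_iSup (fun n => W n x) (n + 1)) (by positivity)

lemma kappa_le {G : Ω → Ω → ℝ≥0∞} {κ : ℝ} (hG : IsQuasiMetricKernel G κ) {q : ℝ} (hq0 : 0 < q)
    {σ : Measure Ω} [IsFiniteMeasure σ] {w : Ω → ℝ≥0∞} (hw : Measurable w)
    (hw1 : ∀ x, 1 ≤ w x) (hfin : ∫⁻ x, w x ∂σ < ∞)
    (hpot : ∀ x, pot G (σ.withDensity w) x ≤ w x ^ (1 / q)) (hW0 : ∫⁻ x, w x ∂σ ≠ 0) :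
    kappa G q σ ≤ (Dq q * ∫⁻ x, w x ∂σ) ^ (1 / q)
      * (ENNReal.ofReal (3 * κ) * (∫⁻ x, w x ∂σ)⁻¹) := by
  have hκ : 0 < κ := by linarith [hG.2.1]
  set c := ENNReal.ofReal (3 * κ) with hc
  have hc0 : c ≠ 0 := by rw [hc]; simpa using hκ
  have hct : c ≠ ∞ := by rw [hc]; exact ENNReal.ofReal_ne_top
  have hfinm : IsFiniteMeasure (σ.withDensity w) := isFiniteMeasure_withDensity hfin.ne
  set ω := σ.withDensity w with hω
  have hωu : ω univ = ∫⁻ x, w x ∂σ := by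
    rw [hω, withDensity_apply _ MeasurableSet.univ, Measure.restrict_univ]
  rw [← hωu] at hfin hW0 ⊢
  set A := ω univ with hA
  refine sInf_le fun ν hν => ?_
  by_cases hν0 : ν univ = 0
  · have : ν = 0 := Measure.measure_univ_eq_zero.1 hν0
    subst this
    simp [lqNorm, pot, hq0]
  have hνt : ν univ ≠ ∞ := measure_ne_top _ _
  set s := c * A⁻¹ * ν univ with hs
  have hAi0 : A⁻¹ ≠ 0 := ENNReal.inv_ne_zero.2 hfin.ne
  have hAit : A⁻¹ ≠ ∞ := ENNReal.inv_ne_top.2 hW0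
  have hs0 : s ≠ 0 := mul_ne_zero (mul_ne_zero hc0 hAi0) hν0
  have hst : s ≠ ∞ := by finiteness
  set f : Ω → ℝ≥0∞ := fun x => pot G ν x / w x ^ (1 / q) with hf
  have hfm : Measurable f := (pot_meas hG ν).div (hw.pow_const _)
  have key : ∫⁻ x, f x ^ q ∂ω ≤ Dq q * s ^ q * A := by
    refine kolmo hq0 ω hfm hs0 hst fun k => ?_
    have hτ0 : 2 ^ k * (A⁻¹ * ν univ) ≠ 0 :=
      mul_ne_zero (by simp) (mul_ne_zero hAi0 hν0)
    have hτt : 2 ^ k * (A⁻¹ * ν univ) ≠ ∞ := by finiteness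
    have hwt := weak_type_s16 hG ν ω hτ0 hτt
    have hsub : {x | 2 ^ k * s < f x} ⊆
        {x | 2 ^ k * (A⁻¹ * ν univ) * c * pot G ω x < pot G ν x} := by
      intro x hx
      have hx : 2 ^ k * s < pot G ν x / w x ^ (1 / q) := hx
      change 2 ^ k * (A⁻¹ * ν univ) * c * pot G ω x < pot G ν x
      have hlt := ENNReal.mul_lt_of_lt_div hx
      refine lt_of_le_of_lt ?_ hlt
      calc 2 ^ k * (A⁻¹ * ν univ) * c * pot G ω x
          ≤ 2 ^ k * (A⁻¹ * ν univ) * c * w x ^ (1 / q) := mul_le_mul_right (hpot x) _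
        _ = _ := by rw [hs]; ring
    have h1 := (mul_le_mul_right (measure_mono hsub) (2 ^ k * (A⁻¹ * ν univ))).trans hwt
    have h2 : ν univ * (A⁻¹ * (2 ^ k * ω {x | 2 ^ k * s < f x})) ≤ ν univ * 1 := by
      rw [mul_one]; refine le_trans (le_of_eq ?_) h1; ring
    have h3 := (ENNReal.mul_le_mul_iff_right hν0 hνt).1 h2
    have h4 := mul_le_mul_right h3 A
    rwa [← mul_assoc, ENNReal.mul_inv_cancel hW0 hfin.ne, one_mul, mul_one] at h4
  have hint : ∫⁻ x, pot G ν x ^ q ∂σ = ∫⁻ x, f x ^ q ∂ω := by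
    rw [hω, lintegral_withDensity_eq_lintegral_mul _ hw (hfm.pow_const q)]
    have hae : ∀ᵐ x ∂σ, w x < ∞ := by
      refine ae_lt_top hw ?_
      rw [← hωu]; exact hfin.ne
    refine lintegral_congr_ae ?_
    filter_upwards [hae] with x hx
    have hu0 : w x ^ (1 / q) ≠ 0 :=
      (ENNReal.rpow_pos (lt_of_lt_of_le one_pos (hw1 x)) hx.ne).ne'
    have hut : w x ^ (1 / q) ≠ ∞ := ENNReal.rpow_ne_top_of_nonneg (by positivity) hx.ne
    have e1 : w x = (w x ^ (1 / q)) ^ q := by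
      rw [← ENNReal.rpow_mul, one_div_mul_cancel hq0.ne', ENNReal.rpow_one]
    calc pot G ν x ^ q = (w x ^ (1 / q) * f x) ^ q := by
          rw [hf]; simp only; rw [ENNReal.mul_div_cancel hu0 hut]
      _ = w x * f x ^ q := by rw [ENNReal.mul_rpow_of_nonneg _ _ hq0.le, ← e1]
  rw [lqNorm, hint]
  refine (ENNReal.rpow_le_rpow key (by positivity)).trans (le_of_eq ?_)
  calc (Dq q * s ^ q * A) ^ (1 / q) = (Dq q * A * s ^ q) ^ (1 / q) := by ring_nf
    _ = (Dq q * A) ^ (1 / q) * s := by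
      rw [ENNReal.mul_rpow_of_nonneg _ _ (by positivity), ← ENNReal.rpow_mul,
        mul_one_div_cancel hq0.ne', ENNReal.rpow_one]
    _ = _ := by rw [hs]; ring

/-- the constant -/
def Kc (κ q : ℝ) : ℝ≥0∞ := (Dq q * ENNReal.ofReal (3 * κ) ^ q) ^ (1 / (1 - q))

lemma Kc_lt {κ q : ℝ} (hq0 : 0 < q) (hq1 : q < 1) : Kc κ q < ∞ := by
  have h1 : 0 < 1 - q := by linarith
  refine ENNReal.rpow_lt_top_of_nonneg (by positivity) (ENNReal.mul_lt_top (Dq_lt hq1) ?_).ne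
  exact ENNReal.rpow_lt_top_of_nonneg hq0.le ENNReal.ofReal_ne_top

lemma kappa_restrict_le {G : Ω → Ω → ℝ≥0∞} {κ : ℝ} (hG : IsQuasiMetricKernel G κ) {q : ℝ}
    (hq0 : 0 < q) (hq1 : q < 1)
    {σ : Measure Ω} [IsFiniteMeasure σ] {w : Ω → ℝ≥0∞} (hw : Measurable w)
    (hw1 : ∀ x, 1 ≤ w x) (hfin : ∫⁻ x, w x ∂σ < ∞)
    (hpot : ∀ x, pot G (σ.withDensity w) x ≤ w x ^ (1 / q)) {B : Set Ω} (hB : MeasurableSet B) :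
    kappa G q (σ.restrict B) ^ (q / (1 - q)) ≤ Kc κ q * σ.withDensity w B := by
  have h1 : 0 < 1 - q := by linarith
  have hp : 0 < q / (1 - q) := by positivity
  rw [withDensity_apply _ hB]
  set A := ∫⁻ x in B, w x ∂σ with hA
  have hAt : A ≠ ∞ := ((setLIntegral_le_lintegral _ _).trans_lt hfin).ne
  by_cases hA0 : A = 0
  · have hz : σ.restrict B = 0 := by
      rw [← Measure.measure_univ_eq_zero, ← nonpos_iff_eq_zero, ← hA0, hA]
      calc (σ.restrict B) univ = ∫⁻ x in B, 1 ∂σ := by simp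
        _ ≤ _ := lintegral_mono fun x => hw1 x
    have hk : kappa G q (σ.restrict B) = 0 := by
      rw [hz, ← nonpos_iff_eq_zero]
      refine sInf_le fun ν hν => ?_
      simp [lqNorm, hq0]
    rw [hk, ENNReal.zero_rpow_of_pos hp]; exact zero_le
  · have := kappa_le hG hq0 (σ := σ.restrict B) hw hw1 hAt.lt_top (fun x => ?_) hA0
    · rw [← hA] at this
      refine (ENNReal.rpow_le_rpow this hp.le).trans (le_of_eq ?_)
      have e : q / (1 - q) = q * (1 / (1 - q)) := by ring
      rw [e, ENNReal.rpow_mul, Kc]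
      have e2 : ((Dq q * A) ^ (1 / q) * (ENNReal.ofReal (3 * κ) * A⁻¹)) ^ q
          = Dq q * ENNReal.ofReal (3 * κ) ^ q * A ^ (1 - q) := by
        rw [ENNReal.mul_rpow_of_nonneg _ _ hq0.le, ← ENNReal.rpow_mul,
          one_div_mul_cancel hq0.ne', ENNReal.rpow_one, ENNReal.mul_rpow_of_nonneg _ _ hq0.le,
          ENNReal.rpow_sub _ _ hA0 hAt, ENNReal.rpow_one, ENNReal.inv_rpow, div_eq_mul_inv]
        ring
      rw [e2, ENNReal.mul_rpow_of_nonneg _ _ (by positivity), ← ENNReal.rpow_mul,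
        mul_one_div_cancel h1.ne', ENNReal.rpow_one]
    · refine le_trans ?_ (hpot x)
      rw [← restrict_withDensity hB]
      exact lintegral_mono' Measure.restrict_le_self le_rfl

/-- set function for kappa -/
def kF (G : Ω → Ω → ℝ≥0∞) (q : ℝ) (σ : Measure Ω) (s : Set Ω) : ℝ≥0∞ :=
  kappa G q (σ.restrict s) ^ (q / (1 - q))

lemma kF_mono (G : Ω → Ω → ℝ≥0∞) {q : ℝ} (hq0 : 0 < q) (hq1 : q < 1) (σ : Measure Ω) :
    Monotone (kF G q σ) := fun s t hst =>
  ENNReal.rpow_le_rpow (kappa_mono G hq0 (Measure.restrict_mono hst le_rfl))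
    (div_nonneg hq0.le (by linarith))

lemma m_mono (σ : Measure Ω) : Monotone (fun s => σ s) := fun _ _ hst => measure_mono hst

lemma pot_fin {G : Ω → Ω → ℝ≥0∞} {κ : ℝ} (hG : IsQuasiMetricKernel G κ) {q : ℝ} (hq0 : 0 < q)
    {σ : Measure Ω} (h : kappa G q σ < ∞) (ν : Measure Ω)
    [hν : IsFiniteMeasure ν] : ∀ᵐ x ∂σ, pot G ν x < ∞ := by
  obtain ⟨C, hC, hCν⟩ := kappa_attained hq0 h
  have h1 : ∫⁻ x, pot G ν x ^ q ∂σ ≠ ∞ := by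
    refine ((hCν ν hν).trans_lt (ENNReal.rpow_lt_top_of_nonneg hq0.le ?_)).ne
    have := measure_ne_top ν univ
    finiteness
  filter_upwards [ae_lt_top ((pot_meas hG ν).pow_const q) h1] with x hx
  by_contra hcon
  have : pot G ν x = ∞ := by simpa using hcon
  rw [this, ENNReal.top_rpow_of_pos hq0] at hx
  exact lt_irrefl _ hx

/-- pointwise: local comparison plus tail gives finiteness -/
lemma tl_zero_fin {G : Ω → Ω → ℝ≥0∞} {κ : ℝ} (hG : IsQuasiMetricKernel G κ)
    {F : Set Ω → ℝ≥0∞} (ν : Measure Ω) [SFinite ν] {x : Ω} {a : ℝ} (ha : 0 < a)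
    {K : ℝ≥0∞} (hK : K < ∞) (hpot : pot G ν x < ∞)
    (hle : ∀ r, 0 < r → r ≤ a → F (ball G x r) ≤ K * ν (ball G x r)) (ht : tl G F x a < ∞) :
    tl G F x 0 < ∞ := by
  rw [tl_split G F x ha]
  refine ENNReal.add_lt_top.2 ⟨?_, ht⟩
  refine lt_of_le_of_lt ?_ (ENNReal.mul_lt_top hK hpot)
  rw [pot_eq hG, tl, ← lintegral_const_mul' _ _ hK.ne]
  refine le_trans ?_ (lintegral_mono_set (Ioc_subset_Ioi_self (a := a) (b := 0)))
  refine setLIntegral_mono' measurableSet_Ioc fun r hr => ?_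
  rw [← mul_div_assoc]
  exact ENNReal.div_le_div_right (hle r hr.1 hr.2) _

lemma local_ae {G : Ω → Ω → ℝ≥0∞} {κ : ℝ} (hG : IsQuasiMetricKernel G κ) {q : ℝ}
    (hq0 : 0 < q) (hq1 : q < 1) (μ σ : Measure Ω) [SFinite μ] [SFinite σ]
    (hgr : ∀ x₀ : Ω, ∀ a : ℝ, 0 < a → growthConds G q σ μ x₀ a) (x₀ : Ω) {a : ℝ} (ha : 0 < a) :
    ∀ᵐ x ∂(σ.restrict (ball G x₀ a)),
      pot G σ x < ∞ ∧ kpot G q σ x < ∞ ∧ pot G μ x < ∞ := by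
  have hκ : 1 / 2 ≤ κ := hG.2.1
  set B := ball G x₀ (κ * (a + a)) with hB
  have hBm : MeasurableSet B := ball_meas hG _ _
  have hb : 0 < κ * (a + a) := by positivity
  obtain ⟨g1, g2, g3⟩ := hgr x₀ (κ * (a + a)) hb
  have hσB : σ B < ∞ := tl_fin (m_mono σ) hb g1
  have hμB : μ B < ∞ := tl_fin (m_mono μ) hb g3
  have hkB : kappa G q (σ.restrict B) < ∞ := by
    have h2 : kF G q σ B < ∞ := tl_fin (kF_mono G hq0 hq1 σ) hb g2
    have hp : 0 < q / (1 - q) := div_pos hq0 (by linarith)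
    by_contra hcon
    have h3 : kappa G q (σ.restrict B) = ∞ := by simpa using hcon
    rw [kF, h3, ENNReal.top_rpow_of_pos hp] at h2
    exact lt_irrefl _ h2
  haveI : IsFiniteMeasure (σ.restrict B) := ⟨by simpa using hσB⟩
  haveI : IsFiniteMeasure (μ.restrict B) := ⟨by simpa using hμB⟩
  obtain ⟨w, hw, hw1, hwfin, hwpot⟩ := supersol hG hq0 hq1 hkB
  have hsubB : ball G x₀ a ⊆ B := ball_mono G x₀ (by nlinarith)
  have hmem : ∀ᵐ x ∂(σ.restrict (ball G x₀ a)), x ∈ ball G x₀ a :=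
    ae_restrict_mem (ball_meas hG _ _)
  have hac := ae_mono (Measure.restrict_mono hsubB (le_refl σ))
  have e1 := hac (pot_fin hG hq0 hkB (σ.restrict B))
  have e2 := hac (pot_fin hG hq0 hkB (μ.restrict B))
  have e3 := hac (ae_lt_top hw hwfin.ne)
  filter_upwards [hmem, e1, e2, e3] with x hx h1 h2 h3
  obtain ⟨t1, t2, t3⟩ := hgr x a ha
  have hsub : ∀ r, 0 < r → r ≤ a → ball G x r ⊆ B := fun r hr hra y hy =>
    qm_lt hG ha ha hx (ball_mono G x hra hy)
  refine ⟨?_, ?_, ?_⟩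
  · rw [pot_eq hG]
    refine tl_zero_fin hG (σ.restrict B) ha ENNReal.one_lt_top h1 (fun r hr hra => ?_) t1
    rw [one_mul, Measure.restrict_apply (ball_meas hG _ _), inter_eq_left.2 (hsub r hr hra)]
  · have hwx : pot G ((σ.restrict B).withDensity w) x < ∞ :=
      (hwpot x).trans_lt (ENNReal.rpow_lt_top_of_nonneg (by positivity) h3.ne)
    refine tl_zero_fin hG (F := kF G q σ) _ ha (Kc_lt (κ := κ) hq0 hq1) hwx
      (fun r hr hra => ?_) t2
    have := kappa_restrict_le hG hq0 hq1 hw hw1 hwfin hwpot (ball_meas hG x r)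
    rwa [Measure.restrict_restrict (ball_meas hG x r), inter_eq_left.2 (hsub r hr hra)] at this
  · rw [pot_eq hG]
    refine tl_zero_fin hG (μ.restrict B) ha ENNReal.one_lt_top h2 (fun r hr hra => ?_) t3
    rw [one_mul, Measure.restrict_apply (ball_meas hG _ _), inter_eq_left.2 (hsub r hr hra)]

lemma global_ae {G : Ω → Ω → ℝ≥0∞} {κ : ℝ} (hG : IsQuasiMetricKernel G κ) {q : ℝ}
    (hq0 : 0 < q) (hq1 : q < 1) (μ σ : Measure Ω) [SFinite μ] [SFinite σ]
    (hgr : ∀ x₀ : Ω, ∀ a : ℝ, 0 < a → growthConds G q σ μ x₀ a) (x₀ : Ω) :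
    ∀ᵐ x ∂σ, pot G σ x < ∞ ∧ kpot G q σ x < ∞ ∧ pot G μ x < ∞ := by
  have hU : (⋃ n : ℕ, ball G x₀ ((n : ℝ) + 1)) = univ := by
    refine eq_univ_of_forall fun y => ?_
    have hfin : (G x₀ y)⁻¹ ≠ ∞ := ENNReal.inv_ne_top.2 (hG.2.2.1 _ _).ne'
    obtain ⟨n, hn⟩ := exists_nat_ge (G x₀ y)⁻¹.toReal
    refine mem_iUnion.2 ⟨n, ?_⟩
    exact (ENNReal.lt_ofReal_iff_toReal_lt hfin).2 (by linarith)
  rw [← Measure.restrict_univ (μ := σ), ← hU, ae_restrict_iUnion_iff]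
  intro n
  rw [hU, Measure.restrict_univ]
  exact local_ae hG hq0 hq1 μ σ hgr x₀ (by positivity)

lemma growth_transfer {G : Ω → Ω → ℝ≥0∞} {κ : ℝ} (hG : IsQuasiMetricKernel G κ) {q : ℝ}
    (hq0 : 0 < q) (hq1 : q < 1) (μ σ : Measure Ω) {x₁ x₂ x₃ : Ω} {a : ℝ}
    (h1 : tl G (fun s => σ s) x₁ a < ∞) (h2 : tl G (kF G q σ) x₂ a < ∞)
    (h3 : tl G (fun s => μ s) x₃ a < ∞) :
    ∀ x₀ : Ω, ∀ a : ℝ, 0 < a → growthConds G q σ μ x₀ a := fun x₀ _ ha =>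
  ⟨tl_transfer hG (m_mono σ) h1 x₀ ha, tl_transfer hG (kF_mono G hq0 hq1 σ) h2 x₀ ha,
    tl_transfer hG (m_mono μ) h3 x₀ ha⟩

end helpers

/-- for quasi-metric kernels, equivalence of the three finiteness
conditions: σ-a.e. finiteness, non-identical infiniteness, and the growth conditions at
some (equivalently, all) `x₀ ∈ Ω`, `a > 0`. -/
theorem statement16 [LocallyCompactSpace Ω] [T2Space Ω] [SecondCountableTopology Ω]
    [BorelSpace Ω] (G : Ω → Ω → ℝ≥0∞) (κ q : ℝ) (hq0 : 0 < q) (hq1 : q < 1)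
    (μ σ : Measure Ω) [IsLocallyFiniteMeasure μ] [IsLocallyFiniteMeasure σ] (hσ : σ ≠ 0)
    (hG : IsQuasiMetricKernel G κ) :
    ((∀ᵐ x ∂σ, pot G σ x < ∞ ∧ kpot G q σ x < ∞ ∧ pot G μ x < ∞) ↔
      ((∃ x, pot G σ x < ∞) ∧ (∃ x, kpot G q σ x < ∞) ∧ ∃ x, pot G μ x < ∞)) ∧
    (((∃ x, pot G σ x < ∞) ∧ (∃ x, kpot G q σ x < ∞) ∧ ∃ x, pot G μ x < ∞) ↔
      ∃ x₀ : Ω, ∃ a : ℝ, 0 < a ∧ growthConds G q σ μ x₀ a) ∧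
    ((∃ x₀ : Ω, ∃ a : ℝ, 0 < a ∧ growthConds G q σ μ x₀ a) ↔
      ∀ x₀ : Ω, ∀ a : ℝ, 0 < a → growthConds G q σ μ x₀ a) := by
  have hne : Nonempty Ω := by
    by_contra hcon
    rw [not_nonempty_iff] at hcon
    exact hσ (Measure.eq_zero_of_isEmpty σ)
  obtain ⟨z⟩ := hne
  have hij : (∀ᵐ x ∂σ, pot G σ x < ∞ ∧ kpot G q σ x < ∞ ∧ pot G μ x < ∞) →
      ((∃ x, pot G σ x < ∞) ∧ (∃ x, kpot G q σ x < ∞) ∧ ∃ x, pot G μ x < ∞) := by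
    intro h
    haveI : (ae σ).NeBot := ae_neBot.2 hσ
    obtain ⟨x, h1, h2, h3⟩ := h.exists
    exact ⟨⟨x, h1⟩, ⟨x, h2⟩, ⟨x, h3⟩⟩
  have hall : ((∃ x, pot G σ x < ∞) ∧ (∃ x, kpot G q σ x < ∞) ∧ ∃ x, pot G μ x < ∞) →
      ∀ x₀ : Ω, ∀ a : ℝ, 0 < a → growthConds G q σ μ x₀ a := by
    rintro ⟨⟨x₁, h1⟩, ⟨x₂, h2⟩, ⟨x₃, h3⟩⟩
    rw [pot_eq hG] at h1 h3
    exact growth_transfer hG hq0 hq1 μ σ h1 h2 h3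
  have hea : (∃ x₀ : Ω, ∃ a : ℝ, 0 < a ∧ growthConds G q σ μ x₀ a) →
      ∀ x₀ : Ω, ∀ a : ℝ, 0 < a → growthConds G q σ μ x₀ a := by
    rintro ⟨x₀, a, -, h1, h2, h3⟩
    exact growth_transfer hG hq0 hq1 μ σ h1 h2 h3
  have hai : (∀ x₀ : Ω, ∀ a : ℝ, 0 < a → growthConds G q σ μ x₀ a) →
      ∀ᵐ x ∂σ, pot G σ x < ∞ ∧ kpot G q σ x < ∞ ∧ pot G μ x < ∞ :=
    fun h => global_ae hG hq0 hq1 μ σ h z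
  exact ⟨⟨hij, fun h => hai (hall h)⟩, ⟨fun h => ⟨z, 1, one_pos, hall h z 1 one_pos⟩,
    fun h => hij (hai (hea h))⟩, ⟨hea, fun h => ⟨z, 1, one_pos, h z 1 one_pos⟩⟩⟩

end NPE
end
end
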